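/- Let F be a finite field with q elements. Every string C-group representation of the projective general linear group PGL(2,F) has rank at most 4, and PGL(2,F) has a string C-group representation of rank 4 if and only if q = 5. -/

import Mathlib

/-- A string C-group representation of rank `n` of a group `G`: a family of `n`
involutions generating `G`, satisfying the commuting (string) property and the
intersection property. -/
def IsStringCGroupRep {G : Type*} [Group G] {n : ℕ} (ρ : Fin n → G) : Prop :=
  (∀ i, orderOf (ρ i) = 2) ∧
  Subgroup.closure (Set.range ρ) = ⊤ ∧
  (∀ i j : Fin n, i.val + 1 < j.val → Commute (ρ i) (ρ j)) ∧
  (∀ I J : Set (Fin n),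
    Subgroup.closure (ρ '' I) ⊓ Subgroup.closure (ρ '' J) = Subgroup.closure (ρ '' (I ∩ J)))

/-- The projective general linear group: the quotient of `GL(n, R)` by its center. -/
abbrev ProjectiveGeneralLinearGroup (n : Type*) [DecidableEq n] [Fintype n]
    (R : Type*) [CommRing R] : Type _ :=
  Matrix.GeneralLinearGroup n R ⧸ Subgroup.center (Matrix.GeneralLinearGroup n R)

/-- An action of `H` in which every non-identity element fixes one or two points, together with the
multiplier `χ g x` of each `g` at each of its fixed points `x`. -/
structure IsMultiplier {H Ω K : Type*} [Group H] [MulAction H Ω] [Field K] (p : ℕ)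
    (χ : H → Ω → K) : Prop where
  map_mul : ∀ {x : Ω} {g h : H}, g • x = x → h • x = x → χ (g * h) x = χ g x * χ h x
  ne_zero : ∀ {x : Ω} {g : H}, g • x = x → χ g x ≠ 0
  unique_fixed : ∀ {x y : Ω} {g : H}, g • x = x → χ g x = 1 → g ≠ 1 → g • y = y → y = x
  exists_other : ∀ {x : Ω} {g : H}, g • x = x → χ g x ≠ 1 →
    ∃ y, y ≠ x ∧ g • y = y ∧ ∀ z, g • z = z → z = x ∨ z = y
  exists_fixed : ∀ g : H, ∃ x : Ω, g • x = x
  pow_eq_one : ∀ {x : Ω} {g : H}, g • x = x → χ g x = 1 → g ^ p = 1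

namespace IsMultiplier

variable {H Ω K : Type*} [Group H] [MulAction H Ω] [Field K] {p : ℕ} {χ : H → Ω → K}

lemma map_one (hχ : IsMultiplier p χ) (x : Ω) : χ 1 x = 1 := by
  have h := hχ.map_mul (one_smul H x) (one_smul H x)
  rw [one_mul] at h
  exact (mul_eq_left₀ (hχ.ne_zero (one_smul H x))).mp h.symm

/-- The multiplier at `x`, as a homomorphism on the stabilizer of `x`. -/
noncomputable def stabHom (hχ : IsMultiplier p χ) (x : Ω) : MulAction.stabilizer H x →* Kˣ :=
  MonoidHom.mk' (fun g => Units.mk0 (χ g x) (hχ.ne_zero g.2))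
    (fun g h => Units.ext (hχ.map_mul g.2 h.2))

lemma mem_ker_stabHom (hχ : IsMultiplier p χ) {x : Ω} (g : MulAction.stabilizer H x) :
    g ∈ (hχ.stabHom x).ker ↔ χ g x = 1 := by
  rw [MonoidHom.mem_ker, Units.ext_iff]; rfl

lemma eq_one_iff (hχ : IsMultiplier p χ) {x : Ω} {g : H} (hg : g • x = x) :
    χ g x = 1 ↔ g = 1 ∨ ∀ y, g • y = y → y = x := by
  constructor
  · intro h
    by_cases h1 : g = 1
    · exact Or.inl h1
    · exact Or.inr fun y hy => hχ.unique_fixed hg h h1 hy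
  · rintro (rfl | h)
    · exact hχ.map_one x
    · by_contra hne
      obtain ⟨y, hy, hgy, -⟩ := hχ.exists_other hg hne
      exact hy (h y hgy)

/-- The number of elements of the stabilizer of `x` with multiplier one. -/
noncomputable def unip (hχ : IsMultiplier p χ) (x : Ω) : ℕ := Nat.card (hχ.stabHom x).ker

lemma unip_eq (hχ : IsMultiplier p χ) (x : Ω) :
    hχ.unip x = Nat.card {g : H // g • x = x ∧ χ g x = 1} := by
  refine Nat.card_congr
    { toFun := fun g => ⟨g.1.1, g.1.2, (hχ.mem_ker_stabHom g.1).mp g.2⟩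
      invFun := fun g => ⟨⟨g.1, g.2.1⟩, (hχ.mem_ker_stabHom _).mpr g.2.2⟩
      left_inv := fun _ => rfl
      right_inv := fun _ => rfl }

lemma unip_smul (hχ : IsMultiplier p χ) (x : Ω) (k : H) : hχ.unip (k • x) = hχ.unip x := by
  rw [unip_eq, unip_eq]
  refine Nat.card_congr ((MulAut.conj k).toEquiv.subtypeEquiv fun g => ?_).symm
  have hfix : ∀ y : Ω, (k * g * k⁻¹) • y = y ↔ g • (k⁻¹ • y) = k⁻¹ • y := fun y => by
    rw [mul_smul, mul_smul, eq_inv_smul_iff]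
  have h1 : (k * g * k⁻¹) • k • x = k • x ↔ g • x = x := by rw [hfix, inv_smul_smul]
  change _ ↔ (k * g * k⁻¹) • k • x = k • x ∧ χ (k * g * k⁻¹) (k • x) = 1
  rw [h1]
  refine and_congr_right fun hg => ?_
  rw [hχ.eq_one_iff hg, hχ.eq_one_iff (h1.mpr hg)]
  refine or_congr (by simp [conj_eq_one_iff]) ?_
  constructor
  · intro h y hy
    rw [← inv_smul_eq_iff]
    exact h _ ((hfix y).mp hy)
  · intro h y hy
    have := h (k • y) ((hfix _).mpr (by rwa [inv_smul_smul]))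
    exact smul_left_cancel k this

lemma card_stabilizer_smul (x : Ω) (k : H) :
    Nat.card (MulAction.stabilizer H (k • x)) = Nat.card (MulAction.stabilizer H x) :=
  Nat.card_congr (MulAction.stabilizerEquivStabilizer (g := k) rfl).toEquiv.symm

variable [Finite H]

omit [Finite H] in
lemma card_stabilizer_eq (hχ : IsMultiplier p χ) (x : Ω) :
    hχ.unip x * Nat.card (hχ.stabHom x).range = Nat.card (MulAction.stabilizer H x) := by
  rw [unip, ← Subgroup.index_ker, Subgroup.card_mul_index]

lemma unip_eq_pow [Fact p.Prime] (hχ : IsMultiplier p χ) (x : Ω) : ∃ m, hχ.unip x = p ^ m := by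
  refine IsPGroup.iff_card.mp fun g => ⟨1, ?_⟩
  rw [pow_one]
  ext
  exact hχ.pow_eq_one g.1.2 ((hχ.mem_ker_stabHom g.1).mp g.2)

lemma coprime_card_range [Fact p.Prime] [CharP K p] (hχ : IsMultiplier p χ) (x : Ω) :
    Nat.Coprime p (Nat.card (hχ.stabHom x).range) := by
  rw [Nat.Prime.coprime_iff_not_dvd Fact.out]
  intro h
  have : Finite (hχ.stabHom x).range := Set.finite_range (hχ.stabHom x)
  obtain ⟨g, hg⟩ := exists_prime_orderOf_dvd_card' p h
  have h1 : ((g : Kˣ) : K) ^ p = 1 := by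
    have := pow_orderOf_eq_one g
    rw [hg] at this
    simpa using congrArg (fun u : (hχ.stabHom x).range => ((u : Kˣ) : K)) this
  have h2 : ((g : Kˣ) : K) = 1 := by
    have : (((g : Kˣ) : K) - 1) ^ p = 0 := by rw [sub_pow_char, h1, one_pow, sub_self]
    exact sub_eq_zero.mp (pow_eq_zero_iff (Nat.Prime.ne_zero Fact.out) |>.mp this)
  have h3 : g = 1 := Subtype.ext (Units.ext h2)
  rw [h3, orderOf_one] at hg
  exact (Fact.out : p.Prime).one_lt.ne hg

/-- The stabilizer of a point acts by conjugation on the non-identity elements with multiplier one,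
and only elements with multiplier one fix any of them. -/
lemma card_range_lt (hχ : IsMultiplier p χ) (x : Ω) (h1 : hχ.unip x ≠ 1) :
    Nat.card (hχ.stabHom x).range + 1 ≤ hχ.unip x := by
  have hnt : (hχ.stabHom x).ker ≠ ⊥ := fun h => h1 (by rw [unip, h, Subgroup.card_bot])
  obtain ⟨⟨u, hu⟩, hu1⟩ := Subgroup.ne_bot_iff_exists_ne_one.mp hnt
  replace hu1 : u ≠ 1 := fun h => hu1 (Subtype.ext h)
  have huχ := (hχ.mem_ker_stabHom u).mp hu
  have hu1' : (u : H) ≠ 1 := fun h => hu1 (Subtype.ext h)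
  have hcomm : ∀ g : MulAction.stabilizer H x, g * u = u * g → hχ.stabHom x g = 1 := by
    intro g hg
    by_contra hne
    have hne' : χ g x ≠ 1 := fun h => hne ((hχ.mem_ker_stabHom g).mpr h)
    obtain ⟨y, hyx, hgy, hz⟩ := hχ.exists_other g.2 hne'
    have h2 : (g : H) • (u : H) • y = (u : H) • y := by
      rw [← mul_smul, show (g : H) * u = u * g from congrArg Subtype.val hg, mul_smul, hgy]
    rcases hz _ h2 with h | h
    · exact hyx (smul_left_cancel (u : H) (h.trans u.2.symm))
    · exact hyx (hχ.unique_fixed u.2 huχ hu1' h)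
  let f : (hχ.stabHom x).range → (hχ.stabHom x).ker := fun c =>
    ⟨c.2.choose * u * c.2.choose⁻¹, (MonoidHom.normal_ker _).conj_mem _ hu _⟩
  have hf : Function.Injective (fun o : Option (hχ.stabHom x).range => o.elim 1 f) := by
    have hf1 : ∀ c, f c ≠ 1 := fun c h => hu1 (conj_eq_one_iff.mp (congrArg Subtype.val h))
    have hff : Function.Injective f := by
      intro c d h
      have h' : c.2.choose * u * c.2.choose⁻¹ = d.2.choose * u * d.2.choose⁻¹ :=
        congrArg Subtype.val h
      have := hcomm (d.2.choose⁻¹ * c.2.choose) (by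
        have : c.2.choose * u = d.2.choose * u * d.2.choose⁻¹ * c.2.choose := by
          rw [← h']; group
        simp only [mul_assoc] at this ⊢
        rw [this]; group)
      rw [_root_.map_mul, map_inv, c.2.choose_spec, d.2.choose_spec, inv_mul_eq_one] at this
      exact Subtype.ext this.symm
    intro a b h
    cases a <;> cases b
    · rfl
    · exact absurd h.symm (hf1 _)
    · exact absurd h (hf1 _)
    · exact congrArg some (hff h)
  have : Finite (hχ.stabHom x).range := Set.finite_range (hχ.stabHom x)
  have := Nat.card_le_card_of_injective _ hf
  rwa [Finite.card_option] at this

omit [Finite H] in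
open Classical in
lemma sum_fixed [Fintype Ω] (hχ : IsMultiplier p χ) {g : H} (hg : g ≠ 1) :
    ∑ x : Ω, ((if g • x = x then 1 else 0) + (if g • x = x ∧ χ g x = 1 then 1 else 0)) = 2 := by
  obtain ⟨x, hx⟩ := hχ.exists_fixed g
  by_cases h1 : χ g x = 1
  · rw [Finset.sum_eq_single x]
    · simp [hx, h1]
    · intro y _ hy
      have : ¬ g • y = y := fun h => hy (hχ.unique_fixed hx h1 hg h)
      simp [this]
    · simp
  · obtain ⟨y, hyx, hy, hz⟩ := hχ.exists_other hx h1
    have h2 : χ g y ≠ 1 := fun h => hyx (hχ.unique_fixed hy h hg hx).symm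
    rw [← Finset.sum_subset (Finset.subset_univ {x, y}), Finset.sum_pair hyx.symm]
    · simp [hx, hy, h1, h2]
    · intro z _ hz'
      have : ¬ g • z = z := fun h => by
        rcases hz z h with rfl | rfl <;> simp at hz'
      simp [this]

lemma sum_stabilizer [Fintype Ω] (hχ : IsMultiplier p χ) :
    ∑ x : Ω, (Nat.card (MulAction.stabilizer H x) + hχ.unip x) + 2 =
      2 * Fintype.card Ω + 2 * Nat.card H := by
  classical
  have := Fintype.ofFinite H
  have h1 : ∀ x : Ω, Nat.card (MulAction.stabilizer H x) + hχ.unip x =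
      ∑ g : H, ((if g • x = x then 1 else 0) + (if g • x = x ∧ χ g x = 1 then 1 else 0)) := by
    intro x
    rw [unip_eq, Finset.sum_add_distrib, Finset.sum_boole, Finset.sum_boole, Nat.card_eq_fintype_card,
      Nat.card_eq_fintype_card, Fintype.card_subtype]
    congr 1
    exact Fintype.card_subtype _
  simp_rw [h1]
  rw [Finset.sum_comm, ← Finset.add_sum_erase _ _ (Finset.mem_univ (1 : H)),
    Finset.sum_congr rfl (fun g hg => hχ.sum_fixed (Finset.ne_of_mem_erase hg))]
  have : 0 < Fintype.card H := Fintype.card_pos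
  simp [hχ.map_one, Finset.card_erase_of_mem, Nat.card_eq_fintype_card, mul_comm, Finset.card_univ]
  omega

end IsMultiplier

lemma eq_of_orbit_equation {Q k e n : ℕ} (hQ : 3 ≤ Q) (hodd : Odd Q) (hk : k + 1 ≤ Q) (hn : 2 ≤ n)
    (he : 0 < e) (hcop : Nat.Coprime Q e) (heq : e * ((Q - 2) * n + 2) = n * Q * k) :
    (n = Q + 1 ∧ (2 * k = Q - 1 ∧ 2 * e = Q + 1 ∨ k = Q - 1 ∧ e = Q + 1)) ∨
      (Q = 3 ∧ k = 2 ∧ n = 10 ∧ e = 5) := by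
  obtain ⟨r, rfl⟩ : ∃ r, Q = r + 2 := ⟨Q - 2, by omega⟩
  obtain ⟨f, rfl⟩ : ∃ f, n = 1 + f * (r + 2) := by
    have h1 : (r + 2) ∣ r * n + 2 := hcop.dvd_of_dvd_mul_left
      ⟨n * k, by rw [Nat.add_sub_cancel] at heq; rw [heq]; ring⟩
    have h2 : (r + 2) ∣ 2 * (n - 1) := by
      have h3 : 2 * (n - 1) + (r * n + 2) = (r + 2) * n := by
        obtain ⟨m, rfl⟩ : ∃ m, n = m + 1 := ⟨n - 1, by omega⟩
        simp; ring
      exact (Nat.dvd_add_left h1).mp (h3 ▸ dvd_mul_right _ _)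
    obtain ⟨f, hf⟩ := (Nat.Coprime.dvd_of_dvd_mul_left (Nat.coprime_two_right.mpr hodd) h2)
    exact ⟨f, by rw [mul_comm f]; omega⟩
  have hf : 1 ≤ f := by
    rcases Nat.eq_zero_or_pos f with rfl | h
    · omega
    · exact h
  rw [Nat.add_sub_cancel] at heq
  have heq' : e * (1 + f * r) = (1 + f * (r + 2)) * k := by
    have : (r + 2) * (e * (1 + f * r)) = (r + 2) * ((1 + f * (r + 2)) * k) := by
      linear_combination heq
    exact Nat.eq_of_mul_eq_mul_left (by omega) this
  have hdvd : (1 + f * r) ∣ 2 * k := by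
    have h1 : (1 + f * r) ∣ f * (2 * k) := by
      have h2 : (1 + f * r) ∣ (1 + f * r) * k + f * (2 * k) := ⟨e, by linear_combination -heq'⟩
      exact (Nat.dvd_add_right (dvd_mul_right _ _)).mp h2
    exact Nat.Coprime.dvd_of_dvd_mul_left (by simp) h1
  have hk0 : 0 < k := by
    rcases Nat.eq_zero_or_pos k with rfl | h
    · simp at heq'; omega
    · exact h
  obtain ⟨c, hc⟩ := hdvd
  have hc0 : 0 < c := by
    rcases Nat.eq_zero_or_pos c with rfl | h
    · omega
    · exact h
  have hle : (1 + f * r) * c ≤ 2 * (r + 1) := by omega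
  have hf3 : f ≤ 3 := by
    by_contra hlt
    have : 4 * r ≤ f * r := Nat.mul_le_mul_right r (by omega)
    have : 1 + f * r ≤ (1 + f * r) * c := Nat.le_mul_of_pos_right _ hc0
    omega
  interval_cases f
  · left
    have hc2 : c ≤ 2 := by
      by_contra hlt
      have : (1 + 1 * r) * 3 ≤ (1 + 1 * r) * c := Nat.mul_le_mul_left _ (by omega)
      omega
    refine ⟨by ring, ?_⟩
    interval_cases c
    · left
      refine ⟨by omega, ?_⟩
      have : (1 + r) * (2 * e) = (1 + r) * (r + 2 + 1) := by
        linear_combination 2 * heq' + (r + 3) * hc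
      exact Nat.eq_of_mul_eq_mul_left (by omega) this
    · right
      have : k = r + 1 := by omega
      refine ⟨by omega, ?_⟩
      subst this
      have : (1 + r) * e = (1 + r) * (r + 2 + 1) := by linear_combination heq'
      exact Nat.eq_of_mul_eq_mul_left (by omega) this
  · exfalso
    have : c = 1 := by
      by_contra hlt
      have : (1 + 2 * r) * 2 ≤ (1 + 2 * r) * c := Nat.mul_le_mul_left _ (by omega)
      omega
    subst this
    omega
  · right
    have : c = 1 := by
      by_contra hlt
      have : (1 + 3 * r) * 2 ≤ (1 + 3 * r) * c := Nat.mul_le_mul_left _ (by omega)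
      omega
    subst this
    have : r = 1 := by omega
    subst this
    omega

lemma le_five_of_three_orbits {h a b c : ℕ} (hab : a ≤ b) (hbc : b ≤ c) (ha : 2 ≤ a)
    (hc : 3 * c ≤ h) (hs : (1 / a + 1 / b + 1 / c : ℚ) = 1 + 2 / h) :
    a = 2 ∧ b = 3 ∧ (c = 3 ∨ c = 4 ∨ c = 5) := by
  have ha0 : (0 : ℚ) < a := by positivity
  have hb0 : (0 : ℚ) < b := by exact_mod_cast (by omega : 0 < b)
  have hc0 : (0 : ℚ) < c := by exact_mod_cast (by omega : 0 < c)
  have hh0 : (0 : ℚ) < h := by exact_mod_cast (by omega : 0 < h)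
  have hba : (1 / b : ℚ) ≤ 1 / a := one_div_le_one_div_of_le ha0 (by exact_mod_cast hab)
  have hcb : (1 / c : ℚ) ≤ 1 / b := one_div_le_one_div_of_le hb0 (by exact_mod_cast hbc)
  have hpos : (0 : ℚ) < 2 / h := by positivity
  have ha2 : a = 2 := by
    by_contra hne
    have : (1 / a : ℚ) ≤ 1 / 3 :=
      one_div_le_one_div_of_le (by norm_num) (by exact_mod_cast (by omega : 3 ≤ a))
    linarith
  subst ha2
  have hb3 : b ≤ 3 := by
    by_contra hne
    have : (1 / b : ℚ) ≤ 1 / 4 :=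
      one_div_le_one_div_of_le (by norm_num) (by exact_mod_cast (by omega : 4 ≤ b))
    push_cast at hs
    linarith
  have hb : b = 3 := by
    by_contra hne
    obtain rfl : b = 2 := by omega
    push_cast at hs
    have h1 : (1 / c : ℚ) = 2 / h := by linarith
    rw [div_eq_div_iff hc0.ne' hh0.ne'] at h1
    have : h = 2 * c := by exact_mod_cast (by linarith : (h : ℚ) = 2 * c)
    omega
  subst hb
  have hc5 : c ≤ 5 := by
    by_contra hne
    have : (1 / c : ℚ) ≤ 1 / 6 :=
      one_div_le_one_div_of_le (by norm_num) (by exact_mod_cast (by omega : 6 ≤ c))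
    push_cast at hs
    linarith
  omega

lemma three_orbits {h a b c : ℕ} (ha : 2 ≤ a) (hb : 2 ≤ b) (hc : 2 ≤ c)
    (ha' : 3 * a ≤ h) (hb' : 3 * b ≤ h) (hc' : 3 * c ≤ h)
    (hs : (1 / a + 1 / b + 1 / c : ℚ) = 1 + 2 / h) :
    (a ≤ 4 ∧ b ≤ 4 ∧ c ≤ 4) ∨ (a = 2 ∧ Odd b ∧ Odd c) ∨ (b = 2 ∧ Odd a ∧ Odd c) ∨
      (c = 2 ∧ Odd a ∧ Odd b) := by
  have key : ∀ {a b c : ℕ}, a ≤ b → b ≤ c → 2 ≤ a → 3 * c ≤ h →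
      (1 / a + 1 / b + 1 / c : ℚ) = 1 + 2 / h →
      (a ≤ 4 ∧ b ≤ 4 ∧ c ≤ 4) ∨ (a = 2 ∧ Odd b ∧ Odd c) := by
    intro a b c hab hbc ha hc hs
    obtain ⟨rfl, rfl, rfl | rfl | rfl⟩ := le_five_of_three_orbits hab hbc ha hc hs
    · simp
    · simp
    · right; decide
  rcases le_total a b with h1 | h1 <;> rcases le_total b c with h2 | h2 <;>
    rcases le_total a c with h3 | h3
  · have := key h1 h2 ha hc' (by linarith); tauto
  · have := key h1 h2 ha hc' (by linarith); tauto
  · have := key h3 h2 ha hb' (by linarith); tauto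
  · have := key h3 h1 hc hb' (by linarith); tauto
  · have := key h1 h3 hb hc' (by linarith); tauto
  · have := key h2 h3 hb ha' (by linarith); tauto
  · have := key h2 h1 hc ha' (by linarith); tauto
  · have := key h2 h1 hc ha' (by linarith); tauto

/-- The possible solutions of the orbit equation of a finite group acting with multipliers. -/
lemma orbit_trichotomy {ι : Type*} {p : ℕ} (hp : p.Prime) (hp2 : p ≠ 2) (S : Finset ι)
    (E U k : ι → ℕ) (h : ℕ)
    (hE : ∀ i ∈ S, 2 ≤ E i) (hUk : ∀ i, U i * k i = E i) (hU : ∀ i, ∃ m, U i = p ^ m)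
    (hcop : ∀ i, Nat.Coprime p (k i)) (hk : ∀ i, U i ≠ 1 → k i + 1 ≤ U i)
    (hh : ∀ i ∈ S, ∃ n, 3 ≤ n ∧ h = n * E i) (hh0 : 2 ≤ h)
    (hsum : ∑ i ∈ S, (1 + ((U i : ℚ) - 2) / E i) = 2 - 2 / h) :
    (∀ i ∈ S, E i ≤ 4) ∨
    (∃ i₀ ∈ S, (∃ m, E i₀ = 2 * m ∧ Odd m) ∧ ∀ i ∈ S, i ≠ i₀ → Odd (E i)) ∨
    (∃ m, 1 < p ^ m ∧ p ^ m * ((p ^ m - 1) * (p ^ m + 1)) ≤ 2 * h ∧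
      ∀ i ∈ S, k i ∣ p ^ m - 1 ∨ k i ∣ p ^ m + 1) := by
  classical
  have hhQ : (0 : ℚ) < h := by positivity
  have hpodd : Odd p := hp.odd_of_ne_two hp2
  have hUodd : ∀ i, Odd (U i) := fun i => by obtain ⟨m, hm⟩ := hU i; rw [hm]; exact hpodd.pow
  have hU3 : ∀ i, U i ≠ 1 → 3 ≤ U i := fun i hi => by
    obtain ⟨m, hm⟩ := hUodd i; omega
  have hE0 : ∀ i ∈ S, (0 : ℚ) < E i := fun i hi => by
    have := hE i hi; exact_mod_cast (by omega : 0 < E i)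
  have hterm1 : ∀ i ∈ S, U i = 1 → (1 + ((U i : ℚ) - 2) / E i) = 1 - 1 / E i := fun i hi h1 => by
    rw [h1]; push_cast; ring
  have hterm3 : ∀ i ∈ S, U i ≠ 1 → 1 < 1 + ((U i : ℚ) - 2) / E i := fun i hi h1 => by
    have h3 : (3 : ℚ) ≤ U i := by exact_mod_cast hU3 i h1
    have := div_pos (by linarith : (0 : ℚ) < U i - 2) (hE0 i hi)
    linarith
  have hterm : ∀ i ∈ S, 1 / 2 ≤ 1 + ((U i : ℚ) - 2) / E i := fun i hi => by
    by_cases h1 : U i = 1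
    · rw [hterm1 i hi h1]
      have : (1 / E i : ℚ) ≤ 1 / 2 :=
        one_div_le_one_div_of_le (by norm_num) (by exact_mod_cast hE i hi)
      linarith
    · linarith [hterm3 i hi h1]
  have hpos : (0 : ℚ) < 2 / h := by positivity
  have hthird : ∀ i ∈ S, (3 / h : ℚ) ≤ 1 / E i := fun i hi => by
    obtain ⟨n, hn, hn'⟩ := hh i hi
    rw [div_le_div_iff₀ hhQ (hE0 i hi)]
    exact_mod_cast (by rw [hn', one_mul]; exact Nat.mul_le_mul_right _ hn : 3 * E i ≤ 1 * h)
  by_cases hall : ∀ i ∈ S, U i = 1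
  · have hcard : S.card ≤ 3 := by
      have h1 : (S.card : ℚ) * (1 / 2) ≤ 2 - 2 / h := by
        rw [← hsum, ← nsmul_eq_mul]
        exact Finset.card_nsmul_le_sum _ _ _ hterm
      have : (S.card : ℚ) < 4 := by linarith
      exact Nat.le_of_lt_succ (by exact_mod_cast this)
    rw [Finset.sum_congr rfl (fun i hi => hterm1 i hi (hall i hi))] at hsum
    have h2h : (2 / h : ℚ) ≤ 1 := by
      rw [div_le_one hhQ]; exact_mod_cast hh0
    interval_cases hc : S.card
    · rw [Finset.card_eq_zero] at hc
      rw [hc, Finset.sum_empty] at hsum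
      linarith
    · obtain ⟨a, rfl⟩ := Finset.card_eq_one.mp hc
      rw [Finset.sum_singleton] at hsum
      have := one_div_pos.mpr (hE0 a (by simp))
      linarith
    · obtain ⟨a, b, hab, rfl⟩ := Finset.card_eq_two.mp hc
      rw [Finset.sum_pair hab] at hsum
      have := hthird a (by simp)
      have := hthird b (by simp)
      have e3 : (3 / h : ℚ) = 3 / 2 * (2 / h) := by ring
      linarith
    · obtain ⟨a, b, c, hab, hac, hbc, rfl⟩ := Finset.card_eq_three.mp hc
      rw [Finset.sum_insert (by simp [hab, hac]), Finset.sum_pair hbc] at hsum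
      have hle : ∀ i ∈ ({a, b, c} : Finset ι), 3 * E i ≤ h := fun i hi => by
        obtain ⟨n, hn, hn'⟩ := hh i hi
        rw [hn']; exact Nat.mul_le_mul_right _ hn
      have := three_orbits (hE a (by simp)) (hE b (by simp)) (hE c (by simp)) (hle a (by simp))
        (hle b (by simp)) (hle c (by simp)) (by linarith)
      rcases this with h1 | h1 | h1 | h1
      · left; simpa using h1
      · right; left
        exact ⟨a, by simp, ⟨1, by omega, odd_one⟩, by simp; tauto⟩
      · right; left
        exact ⟨b, by simp, ⟨1, by omega, odd_one⟩, by simp; tauto⟩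
      · right; left
        exact ⟨c, by simp, ⟨1, by omega, odd_one⟩, by simp; tauto⟩
  · push Not at hall
    obtain ⟨x, hx, hx1⟩ := hall
    obtain ⟨n, hn, hn'⟩ := hh x hx
    have hEx := hUk x
    rw [← Finset.add_sum_erase _ _ hx] at hsum
    have hrest1 : ∑ i ∈ S.erase x, (1 + ((U i : ℚ) - 2) / E i) < 1 := by
      linarith [hterm3 x hx hx1]
    have hcard : (S.erase x).card ≤ 1 := by
      have h1 : ((S.erase x).card : ℚ) * (1 / 2) ≤
          ∑ i ∈ S.erase x, (1 + ((U i : ℚ) - 2) / E i) := by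
        rw [← nsmul_eq_mul]
        exact Finset.card_nsmul_le_sum _ _ _ fun i hi => hterm i (Finset.mem_of_mem_erase hi)
      have : ((S.erase x).card : ℚ) < 2 := by linarith
      exact Nat.le_of_lt_succ (by exact_mod_cast this)
    have h3 := hU3 x hx1
    have hkx := hk x hx1
    have hExQ := hE0 x hx
    have hhQ' : (h : ℚ) = n * E x := by exact_mod_cast hn'
    have hn0 : (0 : ℚ) < n := by positivity
    interval_cases hc : (S.erase x).card
    · exfalso
      rw [Finset.card_eq_zero] at hc
      rw [hc, Finset.sum_empty, hhQ'] at hsum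
      field_simp at hsum
      have h4 : (U x : ℚ) ≤ E x := by
        exact_mod_cast (by
          rw [← hEx]
          exact Nat.le_mul_of_pos_right _ (Nat.pos_of_ne_zero fun h0 => by
            have := hE x hx; simp [h0] at hEx; omega) : U x ≤ E x)
      have hn3 : (3 : ℚ) ≤ n := by exact_mod_cast hn
      nlinarith
    · obtain ⟨y, hy⟩ := Finset.card_eq_one.mp hc
      have hyS : y ∈ S := Finset.mem_of_mem_erase (hy ▸ Finset.mem_singleton_self y)
      have hyx : y ≠ x := Finset.ne_of_mem_erase (hy ▸ Finset.mem_singleton_self y)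
      have hcov : ∀ i ∈ S, i = x ∨ i = y := fun i hi => by
        by_cases hix : i = x
        · exact Or.inl hix
        · exact Or.inr (Finset.mem_singleton.mp (hy ▸ Finset.mem_erase.mpr ⟨hix, hi⟩))
      rw [hy, Finset.sum_singleton] at hsum hrest1
      have hUy : U y = 1 := by
        by_contra hne
        linarith [hterm3 y hyS hne]
      have hky : k y = E y := by rw [← hUk y, hUy, one_mul]
      have hEy := hE y hyS
      have hEyQ := hE0 y hyS
      have heq : E y * ((U x - 2) * n + 2) = n * U x * k x := by
        rw [hUy, hhQ'] at hsum
        push_cast at hsum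
        field_simp at hsum
        have : (E y : ℚ) * ((U x - 2) * n + 2) = n * E x := by linarith
        rw [mul_assoc, hEx]
        have h2 : ((U x - 2 : ℕ) : ℚ) = U x - 2 := by push_cast [Nat.cast_sub (by omega : 2 ≤ U x)]; rfl
        exact_mod_cast (by push_cast [h2]; exact this :
          ((E y * ((U x - 2) * n + 2) : ℕ) : ℚ) = ((n * E x : ℕ) : ℚ))
      have hcopy : Nat.Coprime (U x) (E y) := by
        obtain ⟨m, hm⟩ := hU x
        rw [hm, ← hky]
        exact (hcop y).pow_left m
      rcases eq_of_orbit_equation h3 (hUodd x) hkx (by omega) (by omega) hcopy heq with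
        ⟨hnQ, hke⟩ | ⟨hQ3, hk2, -, he5⟩
      · right; right
        obtain ⟨m, hm⟩ := hU x
        refine ⟨m, by omega, ?_, ?_⟩
        · rw [← hm, hn', ← hEx, hnQ]
          have : U x - 1 ≤ 2 * k x := by omega
          calc U x * ((U x - 1) * (U x + 1)) ≤ U x * (2 * k x * (U x + 1)) := by gcongr
            _ = _ := by ring
        · rw [← hm]
          intro i hi
          rcases hcov i hi with rfl | rfl
          · left
            rcases hke with h | h
            · exact ⟨2, by omega⟩
            · exact ⟨1, by omega⟩
          · right
            rw [hky]
            rcases hke with h | h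
            · exact ⟨2, by omega⟩
            · exact ⟨1, by omega⟩
      · right; left
        refine ⟨x, hx, ⟨3, by rw [← hEx, hQ3, hk2], by decide⟩, ?_⟩
        intro i hi hix
        rcases hcov i hi with rfl | rfl
        · exact absurd rfl hix
        · rw [he5]; decide

lemma isConj_of_card_eq_two_mul_odd {S : Type*} [Group S] [Finite S] {m : ℕ} (hm : Odd m)
    (hS : Nat.card S = 2 * m) {u v : S} (hu : orderOf u = 2) (hv : orderOf v = 2) :
    IsConj u v := by
  have hfac : (Nat.card S).factorization 2 = 1 := by
    rw [hS, Nat.factorization_mul (by norm_num) (by rintro rfl; simp at hm),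
      Finsupp.add_apply, Nat.Prime.factorization_self Nat.prime_two,
      Nat.factorization_eq_zero_of_not_dvd (by rwa [← even_iff_two_dvd, Nat.not_even_iff_odd])]
  have hcard : ∀ {w : S}, orderOf w = 2 →
      Nat.card (Subgroup.zpowers w) = 2 ^ (Nat.card S).factorization 2 := fun hw => by
    rw [Nat.card_zpowers, hw, hfac, pow_one]
  obtain ⟨g, hg⟩ := MulAction.exists_smul_eq S (Sylow.ofCard _ (hcard hu)) (Sylow.ofCard _ (hcard hv))
  have h1 : g * u * g⁻¹ ∈ Subgroup.zpowers v := by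
    have h2 : g * u * g⁻¹ ∈ ((g • Sylow.ofCard _ (hcard hu) : Sylow 2 S) : Subgroup S) :=
      Subgroup.smul_mem_pointwise_smul u (MulAut.conj g) _ (Subgroup.mem_zpowers u)
    rw [hg] at h2
    exact h2
  have h3 : orderOf (g * u * g⁻¹) = 2 := by
    rw [← MulAut.conj_apply, MulEquiv.orderOf_eq, hu]
  rw [isConj_iff]
  refine ⟨g, ?_⟩
  obtain ⟨k, hk⟩ := Subgroup.mem_zpowers_iff.mp h1
  have hv2 : v ^ (2 : ℤ) = 1 := by exact_mod_cast hv ▸ pow_orderOf_eq_one v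
  rcases Int.even_or_odd' k with ⟨j, rfl | rfl⟩
  · rw [zpow_mul, hv2, one_zpow] at hk
    rw [← hk, orderOf_one] at h3
    exact absurd h3 (by norm_num)
  · rw [zpow_add, zpow_mul, hv2, one_zpow, one_mul, zpow_one] at hk
    exact hk.symm

namespace IsMultiplier

variable {H Ω K : Type*} [Group H] [MulAction H Ω] [Field K] {p : ℕ} {χ : H → Ω → K} [Finite H]

lemma subgroup {G : Type*} [Group G] [MulAction G Ω] {χ : G → Ω → K} (hχ : IsMultiplier p χ)
    (H : Subgroup G) : IsMultiplier p (fun (g : H) (x : Ω) => χ g x) where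
  map_mul h1 h2 := hχ.map_mul h1 h2
  ne_zero h := hχ.ne_zero h
  unique_fixed h1 h2 h3 h4 := hχ.unique_fixed h1 h2 (fun h => h3 (Subtype.ext h)) h4
  exists_other h1 h2 := hχ.exists_other h1 h2
  exists_fixed g := hχ.exists_fixed g
  pow_eq_one h1 h2 := Subtype.ext (hχ.pow_eq_one h1 h2)

lemma sum_orbits [Fintype Ω] (hχ : IsMultiplier p χ) :
    ∑ᶠ ω : MulAction.orbitRel.Quotient H Ω,
      (1 + ((hχ.unip ω.out : ℚ) - 2) / Nat.card (MulAction.stabilizer H ω.out)) =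
      2 - 2 / Nat.card H := by
  classical
  have := Fintype.ofFinite (MulAction.orbitRel.Quotient H Ω)
  rw [finsum_eq_sum_of_fintype]
  have hh : (Nat.card H : ℚ) ≠ 0 := by exact_mod_cast Nat.card_pos.ne'
  have hs := hχ.sum_stabilizer
  have hs' : ∑ x : Ω, ((Nat.card (MulAction.stabilizer H x) : ℚ) + hχ.unip x - 2) =
      2 * Nat.card H - 2 := by
    rw [Finset.sum_sub_distrib, Finset.sum_const, Finset.card_univ, nsmul_eq_mul]
    have : ((∑ x : Ω, (Nat.card (MulAction.stabilizer H x) + hχ.unip x) + 2 : ℕ) : ℚ) =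
      (2 * Fintype.card Ω + 2 * Nat.card H : ℕ) := congrArg _ hs
    push_cast at this
    linarith
  rw [← Finset.sum_fiberwise Finset.univ
    (fun x : Ω => (Quotient.mk'' x : MulAction.orbitRel.Quotient H Ω))] at hs'
  have hω : ∀ ω : MulAction.orbitRel.Quotient H Ω,
      ∑ x : Ω with Quotient.mk'' x = ω,
        ((Nat.card (MulAction.stabilizer H x) : ℚ) + hχ.unip x - 2) =
      Nat.card H * (1 + ((hχ.unip ω.out : ℚ) - 2) / Nat.card (MulAction.stabilizer H ω.out)) := by
    intro ω
    have hmem : ∀ x : Ω, (Quotient.mk'' x : MulAction.orbitRel.Quotient H Ω) = ω ↔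
        x ∈ MulAction.orbit H ω.out := by
      intro x
      rw [← MulAction.orbitRel_apply]
      constructor
      · intro h
        rw [← Quotient.eq'', h]
        exact (Quotient.out_eq' ω).symm
      · intro h
        exact (Quotient.eq''.mpr h).trans (Quotient.out_eq' ω)
    rw [Finset.sum_congr rfl (g := fun _ =>
      ((Nat.card (MulAction.stabilizer H ω.out) : ℚ) + hχ.unip ω.out - 2))]
    · rw [Finset.sum_const, nsmul_eq_mul]
      have hc : (Finset.univ.filter fun x : Ω => (Quotient.mk'' x : MulAction.orbitRel.Quotient H Ω) = ω).card *
          Nat.card (MulAction.stabilizer H ω.out) = Nat.card H := by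
        rw [← Nat.card_congr (MulAction.orbitProdStabilizerEquivGroup H ω.out), Nat.card_prod]
        congr 1
        rw [← Fintype.card_subtype, ← Nat.card_eq_fintype_card]
        exact Nat.card_congr (Equiv.subtypeEquivRight hmem)
      rw [← hc]
      have : (Nat.card (MulAction.stabilizer H ω.out) : ℚ) ≠ 0 := by
        exact_mod_cast Nat.card_pos.ne'
      push_cast
      field_simp
      ring
    · intro x hx
      obtain ⟨g, rfl⟩ := (hmem x).mp (Finset.mem_filter.mp hx).2
      simp only
      rw [hχ.unip_smul, card_stabilizer_smul]
  rw [Finset.sum_congr rfl (fun ω _ => hω ω), ← Finset.mul_sum] at hs'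
  field_simp
  linarith

/-- The classification of finite groups acting with multipliers, without orbits of size one or
two. -/
theorem classification [Fact p.Prime] (hp2 : p ≠ 2) [CharP K p] [Finite Ω]
    (hχ : IsMultiplier p χ) (hsmall : ∀ x : Ω, 3 ≤ Nat.card (MulAction.orbit H x)) :
    (∀ g : H, orderOf g ≤ 4) ∨
    (∀ u v : H, orderOf u = 2 → orderOf v = 2 → IsConj u v) ∨
    (∃ m, 1 < p ^ m ∧ p ^ m * ((p ^ m - 1) * (p ^ m + 1)) ≤ 2 * Nat.card H ∧
      ∀ (g : H) (x : Ω), g • x = x → χ g x ^ (p ^ m - 1) = 1 ∨ χ g x ^ (p ^ m + 1) = 1) := by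
  classical
  have := Fintype.ofFinite Ω
  have := Fintype.ofFinite (MulAction.orbitRel.Quotient H Ω)
  let St : Ω → ℕ := fun x => Nat.card (MulAction.stabilizer H x)
  let S : Finset (MulAction.orbitRel.Quotient H Ω) := Finset.univ.filter fun ω => St ω.out ≠ 1
  have hmul : ∀ x : Ω, Nat.card H = Nat.card (MulAction.orbit H x) * St x := fun x => by
    rw [← Nat.card_congr (MulAction.orbitProdStabilizerEquivGroup H x), Nat.card_prod]
  have hSpos : ∀ x : Ω, 0 < St x := fun x => Nat.card_pos
  obtain ⟨x₀, -⟩ := hχ.exists_fixed 1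
  have hsum := hχ.sum_orbits
  rw [finsum_eq_sum_of_fintype, ← Finset.sum_subset (Finset.subset_univ S)] at hsum
  swap
  · intro ω _ hω
    have h1 : St ω.out = 1 := by simpa [S] using hω
    have h2 := hχ.card_stabilizer_eq ω.out
    change _ = St ω.out at h2
    rw [h1] at h2
    change 1 + ((hχ.unip ω.out : ℚ) - 2) / (St ω.out : ℕ) = 0
    rw [h1, Nat.eq_one_of_mul_eq_one_right h2]
    norm_num
  have hrep : ∀ x : Ω, ∃ k : H, k • x = (Quotient.mk'' x : MulAction.orbitRel.Quotient H Ω).out := by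
    intro x
    have : (Quotient.mk'' x : MulAction.orbitRel.Quotient H Ω).out ∈ MulAction.orbit H x := by
      rw [← MulAction.orbitRel_apply, ← Quotient.eq'']
      exact Quotient.out_eq' _
    exact this
  have hSt : ∀ x : Ω, St (Quotient.mk'' x : MulAction.orbitRel.Quotient H Ω).out = St x := by
    intro x
    obtain ⟨k, hk⟩ := hrep x
    rw [← hk]
    exact card_stabilizer_smul x k
  have hmemS : ∀ x : Ω, St x ≠ 1 → (Quotient.mk'' x : MulAction.orbitRel.Quotient H Ω) ∈ S := by
    intro x hx
    simpa [S, hSt] using hx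
  have hdvd : ∀ (g : H) (x : Ω), g • x = x → orderOf g ∣ St x := by
    intro g x hx
    have := orderOf_dvd_natCard (⟨g, hx⟩ : MulAction.stabilizer H x)
    rw [← Subgroup.orderOf_coe] at this
    exact this
  have key := orbit_trichotomy (p := p) Fact.out hp2 S (fun ω => St ω.out)
    (fun ω => hχ.unip ω.out) (fun ω => Nat.card (hχ.stabHom ω.out).range) (Nat.card H)
    (fun ω hω => by have := hSpos ω.out; have : St ω.out ≠ 1 := by simpa [S] using hω
                    change 2 ≤ St ω.out; omega)
    (fun ω => hχ.card_stabilizer_eq _) (fun ω => hχ.unip_eq_pow _)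
    (fun ω => hχ.coprime_card_range _) (fun ω => hχ.card_range_lt _)
    (fun ω _ => ⟨_, hsmall ω.out, hmul _⟩)
    (by
      have h1 := hmul x₀
      have h2 := hsmall x₀
      have h3 := Nat.le_mul_of_pos_right (Nat.card (MulAction.orbit H x₀)) (hSpos x₀)
      omega) hsum
  rcases key with h | ⟨ω₀, hω₀, ⟨m, hm, hmodd⟩, hodd⟩ | ⟨m, hm1, hm, hk⟩
  · left
    intro g
    obtain ⟨x, hx⟩ := hχ.exists_fixed g
    have h1 := hdvd g x hx
    by_cases hx1 : St x = 1
    · rw [hx1] at h1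
      have := Nat.le_of_dvd one_pos h1
      omega
    · have := h _ (hmemS x hx1)
      rw [hSt] at this
      exact (Nat.le_of_dvd (hSpos x) h1).trans this
  · right; left
    have hfix : ∀ u : H, orderOf u = 2 → ∃ w : MulAction.stabilizer H ω₀.out,
        orderOf w = 2 ∧ IsConj u w := by
      intro u hu
      obtain ⟨x, hx⟩ := hχ.exists_fixed u
      have h1 := hdvd u x hx
      rw [hu] at h1
      have hx1 : St x ≠ 1 := fun h => by rw [h] at h1; norm_num at h1
      have hω : (Quotient.mk'' x : MulAction.orbitRel.Quotient H Ω) = ω₀ := by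
        by_contra hne
        have := hodd _ (hmemS x hx1) hne
        simp only [hSt] at this
        exact (Nat.not_even_iff_odd.mpr this) (even_iff_two_dvd.mpr h1)
      obtain ⟨k, hk⟩ := hrep x
      rw [hω] at hk
      refine ⟨⟨k * u * k⁻¹, ?_⟩, ?_, isConj_iff.mpr ⟨k, rfl⟩⟩
      · rw [MulAction.mem_stabilizer_iff, ← hk, mul_smul, mul_smul, inv_smul_smul, hx]
      · rw [Subgroup.orderOf_mk, ← MulAut.conj_apply, MulEquiv.orderOf_eq, hu]
    intro u v hu hv
    obtain ⟨a, ha, hua⟩ := hfix u hu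
    obtain ⟨b, hb, hvb⟩ := hfix v hv
    have hab := isConj_of_card_eq_two_mul_odd hmodd hm ha hb
    exact (hua.trans ((MulAction.stabilizer H ω₀.out).subtype.map_isConj hab)).trans hvb.symm
  · right; right
    refine ⟨m, hm1, hm, fun g x hx => ?_⟩
    by_cases hx1 : St x = 1
    · have := hdvd g x hx
      rw [hx1, Nat.dvd_one, orderOf_eq_one_iff] at this
      rw [this, hχ.map_one]
      simp
    · obtain ⟨k, hk'⟩ := hrep x
      have hpow : χ g x ^ Nat.card (hχ.stabHom x).range = 1 := by
        have : (⟨hχ.stabHom x ⟨g, hx⟩, ⟨_, rfl⟩⟩ : (hχ.stabHom x).range) ^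
          Nat.card (hχ.stabHom x).range = 1 := pow_card_eq_one'
        have h2 := congrArg (fun u : (hχ.stabHom x).range => ((u : Kˣ) : K)) this
        simp only [SubmonoidClass.coe_pow, Units.val_pow_eq_pow_val, OneMemClass.coe_one,
          Units.val_one] at h2
        exact h2
      have hcard : Nat.card (hχ.stabHom (Quotient.mk'' x : MulAction.orbitRel.Quotient H Ω).out).range =
          Nat.card (hχ.stabHom x).range := by
        have h1 := hχ.card_stabilizer_eq x
        have h2 := hχ.card_stabilizer_eq (k • x)
        rw [← hk']
        rw [hχ.unip_smul, card_stabilizer_smul, ← h1] at h2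
        exact Nat.eq_of_mul_eq_mul_left Nat.card_pos h2
      have := hk _ (hmemS x hx1)
      simp only [hcard] at this
      refine this.imp (fun h => ?_) (fun h => ?_) <;>
      · obtain ⟨c, hc⟩ := h
        rw [hc, pow_mul, hpow, one_pow]

end IsMultiplier

namespace ProjectiveGeneralLinearGroup

open Matrix
open scoped LinearAlgebra.Projectivization

variable {F : Type*} [Field F]

/-- The image of an invertible matrix in `PGL(2, F)`. -/
abbrev mk (u : GL (Fin 2) F) : ProjectiveGeneralLinearGroup (Fin 2) F := QuotientGroup.mk u

lemma mk_eq_one_iff {u : GL (Fin 2) F} :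
    mk u = 1 ↔ u 0 1 = 0 ∧ u 1 0 = 0 ∧ u 0 0 = u 1 1 := by
  rw [mk, QuotientGroup.eq_one_iff, GeneralLinearGroup.mem_center_iff_val_mem_range_scalar]
  constructor
  · rintro ⟨c, hc⟩
    simp [← hc]
  · rintro ⟨h1, h2, h3⟩
    refine ⟨u 0 0, ?_⟩
    ext i j
    fin_cases i <;> fin_cases j <;> simp [h1, h2, h3]

lemma mk_eq_mk_iff {u w : GL (Fin 2) F} :
    mk u = mk w ↔ ∃ c : F, c ≠ 0 ∧ (u : Matrix (Fin 2) (Fin 2) F) = c • (w : Matrix _ _ F) := by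
  rw [eq_comm, mk, mk, QuotientGroup.eq, GeneralLinearGroup.center_eq_range_scalar]
  constructor
  · rintro ⟨c, hc⟩
    refine ⟨c, c.ne_zero, ?_⟩
    rw [eq_inv_mul_iff_mul_eq] at hc
    rw [← hc]
    simp [Matrix.smul_eq_mul_diagonal]
  · rintro ⟨c, hc, h⟩
    refine ⟨Units.mk0 c hc, ?_⟩
    rw [eq_inv_mul_iff_mul_eq]
    ext1
    rw [h]
    simp [Matrix.smul_eq_mul_diagonal]

lemma det_ne_zero (u : GL (Fin 2) F) : (u : Matrix (Fin 2) (Fin 2) F).det ≠ 0 :=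
  ((Matrix.isUnit_iff_isUnit_det _).mp u.isUnit).ne_zero

section Action

variable {K : Type*} [Field K] [Algebra F K]

variable (F K) in
/-- The action of `PGL(2, F)` on the projective line over an extension of `F`, as a
homomorphism. -/
noncomputable def toPermHom :
    ProjectiveGeneralLinearGroup (Fin 2) F →* Equiv.Perm (ℙ K (Fin 2 → K)) :=
  QuotientGroup.lift _
    ((MulAction.toPermHom (GL (Fin 2) K) (ℙ K (Fin 2 → K))).comp
      (GeneralLinearGroup.map (algebraMap F K))) <| by
    intro u hu
    obtain ⟨c, hc⟩ := GeneralLinearGroup.center_eq_range_scalar.le hu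
    ext x
    induction x using Projectivization.ind with | h v hv =>
    change GeneralLinearGroup.map (algebraMap F K) u • Projectivization.mk K v hv = _
    rw [Projectivization.smul_mk]
    refine (Projectivization.mk_eq_mk_iff' ..).mpr ⟨algebraMap F K c, ?_⟩
    rw [← hc]
    ext i
    fin_cases i <;> simp [Units.smul_def, Matrix.smul_eq_mulVec, Matrix.mulVec_eq_sum, mul_comm]

noncomputable instance : MulAction (ProjectiveGeneralLinearGroup (Fin 2) F) (ℙ K (Fin 2 → K)) :=
  MulAction.compHom _ (toPermHom F K)

/-- The extension of scalars of an invertible matrix, as a matrix. -/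
def ext (K : Type*) [Field K] [Algebra F K] (u : GL (Fin 2) F) : Matrix (Fin 2) (Fin 2) K :=
  (u : Matrix (Fin 2) (Fin 2) F).map (algebraMap F K)

lemma mk_smul_mk (u : GL (Fin 2) F) {v : Fin 2 → K} (hv : v ≠ 0) (hw : ext K u *ᵥ v ≠ 0) :
    mk u • Projectivization.mk K v hv = Projectivization.mk K (ext K u *ᵥ v) hw := rfl

lemma ext_mul (u w : GL (Fin 2) F) : ext K (u * w) = ext K u * ext K w := by
  simp [ext, Matrix.map_mul]

lemma det_ext (u : GL (Fin 2) F) :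
    (ext K u).det = algebraMap F K (u : Matrix (Fin 2) (Fin 2) F).det := by
  rw [ext, ← RingHom.mapMatrix_apply, RingHom.map_det]

lemma trace_ext (u : GL (Fin 2) F) :
    (ext K u).trace = algebraMap F K (u : Matrix (Fin 2) (Fin 2) F).trace := by
  simp [ext, Matrix.trace_fin_two]

lemma det_ext_ne_zero (u : GL (Fin 2) F) : (ext K u).det ≠ 0 := by
  simpa [det_ext] using det_ne_zero u

lemma ext_mulVec_ne_zero (u : GL (Fin 2) F) {v : Fin 2 → K} (hv : v ≠ 0) : ext K u *ᵥ v ≠ 0 :=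
  fun h => det_ext_ne_zero (K := K) u (Matrix.exists_mulVec_eq_zero_iff.mp ⟨v, hv, h⟩)

lemma smul_eq_iff (u : GL (Fin 2) F) (x : ℙ K (Fin 2 → K)) :
    mk u • x = x ↔ ∃ a : K, ext K u *ᵥ x.rep = a • x.rep := by
  conv_lhs => rw [← x.mk_rep, mk_smul_mk u x.rep_nonzero (ext_mulVec_ne_zero u x.rep_nonzero)]
  rw [Projectivization.mk_eq_mk_iff']
  simp only [eq_comm]

open Classical in
/-- The eigenvalue of `M` on the eigenvector `v`. -/
noncomputable def eig (M : Matrix (Fin 2) (Fin 2) K) (v : Fin 2 → K) : K :=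
  if h : ∃ a : K, M *ᵥ v = a • v then h.choose else 0

lemma eig_eq {M : Matrix (Fin 2) (Fin 2) K} {v : Fin 2 → K} (hv : v ≠ 0) {a : K}
    (h : M *ᵥ v = a • v) : eig M v = a := by
  have h' : ∃ a : K, M *ᵥ v = a • v := ⟨a, h⟩
  rw [eig, dif_pos h']
  exact smul_left_injective K hv (h'.choose_spec.symm.trans h)

/-- The multiplier of an element of `PGL(2, F)` at a fixed point on the projective line. -/
noncomputable def multiplier (g : ProjectiveGeneralLinearGroup (Fin 2) F)
    (x : ℙ K (Fin 2 → K)) : K :=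
  (ext K g.out).det / eig (ext K g.out) x.rep ^ 2

lemma multiplier_eq {u : GL (Fin 2) F} {x : ℙ K (Fin 2 → K)} {a : K}
    (h : ext K u *ᵥ x.rep = a • x.rep) : multiplier (mk u) x = (ext K u).det / a ^ 2 := by
  obtain ⟨c, hc, hu⟩ := mk_eq_mk_iff.mp (QuotientGroup.out_eq' (mk u))
  have hext : ext K (Quotient.out (mk u)) = algebraMap F K c • ext K u := by
    rw [ext, ext]
    rw [hu]
    ext i j
    simp
  have hc' : algebraMap F K c ≠ 0 := by simpa
  rw [multiplier]
  change (ext K (Quotient.out (mk u))).det / eig (ext K (Quotient.out (mk u))) x.rep ^ 2 = _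
  rw [hext, eig_eq x.rep_nonzero (a := algebraMap F K c * a)
    (by rw [Matrix.smul_mulVec, h, smul_smul]), Matrix.det_smul, mul_pow]
  simp only [Fintype.card_fin]
  rw [mul_div_mul_left _ _ (pow_ne_zero 2 hc')]

lemma eigenvalue_ne_zero {u : GL (Fin 2) F} {v : Fin 2 → K} (hv : v ≠ 0) {a : K}
    (h : ext K u *ᵥ v = a • v) : a ≠ 0 := by
  rintro rfl
  exact ext_mulVec_ne_zero u hv (by rw [h, zero_smul])

lemma eq_smul_of_cross {v w : Fin 2 → K} (hv : v ≠ 0) (h : v 0 * w 1 = v 1 * w 0) :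
    ∃ c : K, w = c • v := by
  by_cases h0 : v 0 = 0
  · have h1 : v 1 ≠ 0 := fun h1 => hv (by ext i; fin_cases i <;> simp [h0, h1])
    refine ⟨w 1 / v 1, ?_⟩
    ext i
    fin_cases i
    · have : v 1 * w 0 = 0 := by rw [← h, h0, zero_mul]
      simp [h0, (mul_eq_zero.mp this).resolve_left h1]
    · simp [h1]
  · refine ⟨w 0 / v 0, ?_⟩
    ext i
    fin_cases i
    · simp [h0]
    · simp only [Fin.mk_one, Pi.smul_apply, smul_eq_mul]
      field_simp
      linear_combination h

lemma cross_ne_zero {x y : ℙ K (Fin 2 → K)} (hxy : y ≠ x) :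
    x.rep 0 * y.rep 1 ≠ x.rep 1 * y.rep 0 := by
  intro h
  obtain ⟨c, hc⟩ := eq_smul_of_cross x.rep_nonzero h
  apply hxy
  rw [← x.mk_rep, ← y.mk_rep]
  exact (Projectivization.mk_eq_mk_iff' ..).mpr ⟨c, hc.symm⟩

lemma mulVec_fin_two (M : Matrix (Fin 2) (Fin 2) K) (v : Fin 2 → K) {a : K}
    (h : M *ᵥ v = a • v) :
    M 0 0 * v 0 + M 0 1 * v 1 = a * v 0 ∧ M 1 0 * v 0 + M 1 1 * v 1 = a * v 1 := by
  have h0 := congrFun h 0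
  have h1 := congrFun h 1
  simpa [Matrix.mulVec, dotProduct, Fin.sum_univ_two] using And.intro h0 h1

lemma det_eq_mul {M : Matrix (Fin 2) (Fin 2) K} {v w : Fin 2 → K} {a b : K}
    (hv : M *ᵥ v = a • v) (hw : M *ᵥ w = b • w) (hvw : v 0 * w 1 ≠ v 1 * w 0) :
    M.det = a * b := by
  obtain ⟨h1, h2⟩ := mulVec_fin_two M v hv
  obtain ⟨h3, h4⟩ := mulVec_fin_two M w hw
  apply mul_right_cancel₀ (sub_ne_zero.mpr hvw)
  have : (M 0 0 * v 0 + M 0 1 * v 1) * (M 1 0 * w 0 + M 1 1 * w 1) -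
    (M 1 0 * v 0 + M 1 1 * v 1) * (M 0 0 * w 0 + M 0 1 * w 1) =
    a * v 0 * (b * w 1) - a * v 1 * (b * w 0) := by rw [h1, h2, h3, h4]
  rw [Matrix.det_fin_two]
  linear_combination this

lemma eigenvalue_root {M : Matrix (Fin 2) (Fin 2) K} {v : Fin 2 → K} (hv0 : v ≠ 0) {a : K}
    (hv : M *ᵥ v = a • v) : a ^ 2 - M.trace * a + M.det = 0 := by
  obtain ⟨h1, h2⟩ := mulVec_fin_two M v hv
  have h0 : (a ^ 2 - M.trace * a + M.det) * v 0 = 0 := by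
    rw [Matrix.det_fin_two, Matrix.trace_fin_two]
    linear_combination (M 1 1 - a) * h1 - M 0 1 * h2
  have h0' : (a ^ 2 - M.trace * a + M.det) * v 1 = 0 := by
    rw [Matrix.det_fin_two, Matrix.trace_fin_two]
    linear_combination (M 0 0 - a) * h2 - M 1 0 * h1
  by_contra hne
  exact hv0 (by
    ext i
    fin_cases i
    · exact (mul_eq_zero.mp h0).resolve_left hne
    · exact (mul_eq_zero.mp h0').resolve_left hne)

lemma mk_eq_one_of_ext {u : GL (Fin 2) F} {a : K} (h : ext K u = a • 1) : mk u = 1 := by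
  have hinj := (algebraMap F K).injective
  rw [mk_eq_one_iff]
  refine ⟨hinj ?_, hinj ?_, hinj ?_⟩
  · simpa [ext] using congrFun₂ h 0 1
  · simpa [ext] using congrFun₂ h 1 0
  · simpa [ext] using (congrFun₂ h 0 0).trans (congrFun₂ h 1 1).symm

lemma eq_smul_one {M : Matrix (Fin 2) (Fin 2) K} {v w : Fin 2 → K} {a : K}
    (hv : M *ᵥ v = a • v) (hw : M *ᵥ w = a • w) (hvw : v 0 * w 1 ≠ v 1 * w 0) :
    M = a • 1 := by
  obtain ⟨h1, h2⟩ := mulVec_fin_two M v hv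
  obtain ⟨h3, h4⟩ := mulVec_fin_two M w hw
  have hvw' := sub_ne_zero.mpr hvw
  ext i j
  fin_cases i <;> fin_cases j <;> apply mul_right_cancel₀ hvw' <;>
    simp [-mul_eq_mul_right_iff, -mul_eq_zero]
  · linear_combination w 1 * h1 - v 1 * h3
  · linear_combination v 0 * h3 - w 0 * h1
  · linear_combination w 1 * h2 - v 1 * h4
  · linear_combination v 0 * h4 - w 0 * h2

lemma sub_mul_sub (M : Matrix (Fin 2) (Fin 2) K) {a b : K} (hd : M.det = a * b)
    (ht : M.trace = a + b) : (M - b • 1) * (M - a • 1) = 0 := by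
  rw [Matrix.det_fin_two] at hd
  rw [Matrix.trace_fin_two] at ht
  ext i j
  fin_cases i <;> fin_cases j <;> simp [Matrix.mul_apply, Fin.sum_univ_two]
  · linear_combination M 0 0 * ht - hd
  · linear_combination M 0 1 * ht
  · linear_combination M 1 0 * ht
  · linear_combination M 1 1 * ht - hd

theorem isMultiplier (p : ℕ) [Fact p.Prime] [CharP F p]
    (hroot : ∀ b c : F, ∃ a : K, a ^ 2 - algebraMap F K b * a + algebraMap F K c = 0) :
    IsMultiplier p
      (multiplier : ProjectiveGeneralLinearGroup (Fin 2) F → ℙ K (Fin 2 → K) → K) := by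
  have hK : CharP K p := charP_of_injective_algebraMap (algebraMap F K).injective p
  constructor
  · rintro x g h hgx hhx
    induction g using QuotientGroup.induction_on with | H u =>
    induction h using QuotientGroup.induction_on with | H w =>
    obtain ⟨a, ha⟩ := (smul_eq_iff u x).mp hgx
    obtain ⟨b, hb⟩ := (smul_eq_iff w x).mp hhx
    have hab : ext K (u * w) *ᵥ x.rep = (a * b) • x.rep := by
      rw [ext_mul, ← Matrix.mulVec_mulVec, hb, Matrix.mulVec_smul, ha, smul_smul, mul_comm]
    change multiplier (mk (u * w)) x = multiplier (mk u) x * multiplier (mk w) x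
    rw [multiplier_eq ha, multiplier_eq hb, multiplier_eq hab, ext_mul, Matrix.det_mul]
    ring
  · rintro x g hgx
    induction g using QuotientGroup.induction_on with | H u =>
    obtain ⟨a, ha⟩ := (smul_eq_iff u x).mp hgx
    change multiplier (mk u) x ≠ 0
    rw [multiplier_eq ha]
    exact div_ne_zero (det_ext_ne_zero u) (pow_ne_zero 2 (eigenvalue_ne_zero x.rep_nonzero ha))
  · rintro x y g hgx hχ hg1 hgy
    induction g using QuotientGroup.induction_on with | H u =>
    obtain ⟨a, ha⟩ := (smul_eq_iff u x).mp hgx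
    obtain ⟨b, hb⟩ := (smul_eq_iff u y).mp hgy
    have ha0 := eigenvalue_ne_zero x.rep_nonzero ha
    change multiplier (mk u) x = 1 at hχ
    rw [multiplier_eq ha, div_eq_one_iff_eq (pow_ne_zero 2 ha0)] at hχ
    by_contra hxy
    have hc := cross_ne_zero hxy
    rw [det_eq_mul ha hb hc, sq] at hχ
    rw [mul_left_cancel₀ ha0 hχ] at hb
    exact hg1 (mk_eq_one_of_ext (eq_smul_one ha hb hc))
  · rintro x g hgx hχ
    induction g using QuotientGroup.induction_on with | H u =>
    obtain ⟨a, ha⟩ := (smul_eq_iff u x).mp hgx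
    have ha0 := eigenvalue_ne_zero x.rep_nonzero ha
    change multiplier (mk u) x ≠ 1 at hχ
    rw [multiplier_eq ha, Ne, div_eq_one_iff_eq (pow_ne_zero 2 ha0)] at hχ
    have hr := eigenvalue_root x.rep_nonzero ha
    obtain ⟨b, hb⟩ : ∃ b, (ext K u).det = a * b := ⟨(ext K u).det / a, by field_simp⟩
    have hab : a ≠ b := by
      rintro rfl
      exact hχ (by rw [hb, sq])
    have ht : (ext K u).trace = a + b := by
      apply mul_right_cancel₀ ha0
      rw [hb] at hr
      linear_combination -hr
    have hprod := sub_mul_sub _ hb ht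
    obtain ⟨j, hj⟩ : ∃ j, (ext K u - a • 1).col j ≠ 0 := by
      by_contra! hcon
      have h0 : ext K u = a • 1 := by
        rw [← sub_eq_zero]
        ext i j
        exact congrFun (hcon j) i
      apply hχ
      rw [h0, Matrix.det_smul]
      simp
    set w := (ext K u - a • 1).col j with hw
    have hbw : ext K u *ᵥ w = b • w := by
      have h1 : (ext K u - b • 1) *ᵥ w = 0 := by
        ext i
        exact congrFun₂ hprod i j
      rwa [Matrix.sub_mulVec, Matrix.smul_mulVec, Matrix.one_mulVec, sub_eq_zero] at h1
    have hby : ext K u *ᵥ (Projectivization.mk K w hj).rep =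
        b • (Projectivization.mk K w hj).rep := by
      obtain ⟨c, hc⟩ := Projectivization.exists_smul_eq_mk_rep K w hj
      rw [← hc, Units.smul_def, Matrix.mulVec_smul, hbw, smul_comm]
    refine ⟨Projectivization.mk K w hj, ?_, (smul_eq_iff u _).mpr ⟨b, hby⟩, ?_⟩
    · intro h
      rw [h] at hby
      exact hab (smul_left_injective K x.rep_nonzero (ha.symm.trans hby))
    · intro z hz
      obtain ⟨c, hc⟩ := (smul_eq_iff u z).mp hz
      by_contra! hne
      have h1 := det_eq_mul ha hc (cross_ne_zero hne.1)
      have h2 := det_eq_mul hby hc (cross_ne_zero hne.2)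
      exact hab (mul_right_cancel₀ (eigenvalue_ne_zero z.rep_nonzero hc) (h1.symm.trans h2))
  · rintro g
    induction g using QuotientGroup.induction_on with | H u =>
    obtain ⟨a, ha⟩ := hroot (u : Matrix (Fin 2) (Fin 2) F).trace (u : Matrix (Fin 2) (Fin 2) F).det
    rw [← trace_ext, ← det_ext, Matrix.trace_fin_two, Matrix.det_fin_two] at ha
    obtain ⟨v, hv, h⟩ := Matrix.exists_mulVec_eq_zero_iff.mpr
      (show (ext K u - a • 1).det = 0 by
        rw [Matrix.det_fin_two]
        simp
        linear_combination ha)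
    refine ⟨Projectivization.mk K v hv, (smul_eq_iff u _).mpr ⟨a, ?_⟩⟩
    obtain ⟨c, hc⟩ := Projectivization.exists_smul_eq_mk_rep K v hv
    rw [Matrix.sub_mulVec, Matrix.smul_mulVec, Matrix.one_mulVec, sub_eq_zero] at h
    rw [← hc, Units.smul_def, Matrix.mulVec_smul, h, smul_comm]
  · rintro x g hgx hχ
    induction g using QuotientGroup.induction_on with | H u =>
    obtain ⟨a, ha⟩ := (smul_eq_iff u x).mp hgx
    have ha0 := eigenvalue_ne_zero x.rep_nonzero ha
    change multiplier (mk u) x = 1 at hχ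
    rw [multiplier_eq ha, div_eq_one_iff_eq (pow_ne_zero 2 ha0)] at hχ
    have hr := eigenvalue_root x.rep_nonzero ha
    have ht : (ext K u).trace = a + a := by
      apply mul_right_cancel₀ ha0
      rw [hχ] at hr
      linear_combination -hr
    have hprod := sub_mul_sub _ (hχ.trans (sq a)) ht
    have hext : ∀ n, ext K (u ^ n) = ext K u ^ n := by
      intro n
      induction n with
      | zero => simp [ext, Matrix.map_one]
      | succ n ih => rw [pow_succ, ext_mul, ih, pow_succ]
    have hpow : ext K (u ^ p) = a ^ p • 1 := by
      rw [hext, ← sub_eq_zero]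
      have h1 := sub_pow_char_of_commute (p := p) (x := ext K u) (y := a • (1 : Matrix (Fin 2) (Fin 2) K))
        ((Commute.one_right _).smul_right a)
      rw [smul_pow, one_pow] at h1
      rw [← h1]
      exact pow_eq_zero_of_le (Fact.out : p.Prime).two_le (by rw [sq, hprod])
    exact mk_eq_one_of_ext hpow

/-- The multiplier determines the ratio of the squared trace and the determinant. -/
lemma trace_sq_div_det {u : GL (Fin 2) F} {x : ℙ K (Fin 2 → K)} (h : mk u • x = x) :
    algebraMap F K ((u : Matrix (Fin 2) (Fin 2) F).trace ^ 2 /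
      (u : Matrix (Fin 2) (Fin 2) F).det) =
      multiplier (mk u) x + 2 + (multiplier (mk u) x)⁻¹ := by
  obtain ⟨a, ha⟩ := (smul_eq_iff u x).mp h
  have ha0 := eigenvalue_ne_zero x.rep_nonzero ha
  have hr := eigenvalue_root x.rep_nonzero ha
  have hd := det_ext_ne_zero (K := K) u
  rw [multiplier_eq ha, map_div₀, map_pow, ← trace_ext, ← det_ext]
  have ht : (ext K u).trace = (a ^ 2 + (ext K u).det) / a := by
    field_simp
    linear_combination -hr
  rw [ht]
  field_simp
  ring

end Action

end ProjectiveGeneralLinearGroup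

/-- The property that two distinct involutions have at most one further common commuting
involution. -/
def IsCrossUnique (G : Type*) [Group G] : Prop :=
  ∀ ⦃x y u v : G⦄, orderOf x = 2 → orderOf y = 2 → orderOf u = 2 → orderOf v = 2 → x ≠ y →
    u ≠ x → u ≠ y → v ≠ x → v ≠ y → Commute u x → Commute u y → Commute v x → Commute v y → u = v

lemma mul_self_of_orderOf_eq_two {G : Type*} [Group G] {x : G} (hx : orderOf x = 2) :
    x * x = 1 := by
  rw [← sq, ← hx, pow_orderOf_eq_one]

lemma inv_of_orderOf_eq_two {G : Type*} [Group G] {x : G} (hx : orderOf x = 2) : x⁻¹ = x :=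
  inv_eq_of_mul_eq_one_left (mul_self_of_orderOf_eq_two hx)

lemma ne_one_of_orderOf_eq_two {G : Type*} [Group G] {x : G} (hx : orderOf x = 2) : x ≠ 1 := by
  rintro rfl
  simp at hx

lemma orderOf_mul_eq_two {G : Type*} [Group G] {x y : G} (hx : orderOf x = 2)
    (hy : orderOf y = 2) (hxy : x ≠ y) (h : Commute x y) : orderOf (x * y) = 2 := by
  apply orderOf_eq_prime
  · rw [h.mul_pow, sq, sq, mul_self_of_orderOf_eq_two hx, mul_self_of_orderOf_eq_two hy, one_mul]
  · intro h1
    rw [← inv_of_orderOf_eq_two hy] at hxy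
    exact hxy (eq_inv_of_mul_eq_one_left h1)

lemma orderOf_conj_eq {G : Type*} [Group G] (g x : G) : orderOf (g * x * g⁻¹) = orderOf x := by
  rw [← MulAut.conj_apply, MulEquiv.orderOf_eq]

/-- If `z` is an involution commuting with the involutions `x ≠ y`, but not contained in the
group they generate, then `x * y` has odd order. -/
lemma IsCrossUnique.odd_orderOf_mul {G : Type*} [Group G] [Finite G] (hG : IsCrossUnique G)
    {x y z : G} (hx : orderOf x = 2) (hy : orderOf y = 2) (hz : orderOf z = 2)
    (hxy : x ≠ y) (hzx : Commute z x) (hzy : Commute z y)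
    (hmem : z ∉ Subgroup.closure {x, y}) : Odd (orderOf (x * y)) := by
  by_contra hodd
  rw [Nat.not_odd_iff_even] at hodd
  obtain ⟨m, hm⟩ := hodd
  have hpos := orderOf_pos (x * y)
  have hxm : x ∈ Subgroup.closure {x, y} := Subgroup.subset_closure (by simp)
  have hym : y ∈ Subgroup.closure {x, y} := Subgroup.subset_closure (by simp)
  set w := (x * y) ^ m with hw
  have hwm : w ∈ Subgroup.closure {x, y} := pow_mem (mul_mem hxm hym) m
  have hw2 : w * w = 1 := by rw [hw, ← pow_add, ← hm, pow_orderOf_eq_one]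
  have hw1 : w ≠ 1 := fun h => by
    have := orderOf_dvd_of_pow_eq_one h
    have := Nat.le_of_dvd (by omega) this
    omega
  have hwo : orderOf w = 2 := orderOf_eq_prime (by rw [sq, hw2]) hw1
  have hconj : x * (x * y) * x⁻¹ = (x * y)⁻¹ := by
    rw [mul_inv_rev, inv_of_orderOf_eq_two hx, inv_of_orderOf_eq_two hy, ← mul_assoc,
      mul_self_of_orderOf_eq_two hx, one_mul]
  have hwx : Commute w x := by
    have h1 : x * w * x⁻¹ = w⁻¹ := by rw [hw, ← conj_pow, hconj, inv_pow]
    rw [inv_of_orderOf_eq_two hwo] at h1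
    exact (mul_inv_eq_iff_eq_mul.mp h1).symm
  have hwxy : Commute w (x * y) := (Commute.refl (x * y)).pow_left m
  have hwy : Commute w y := by
    have := hwx.mul_right hwxy
    rwa [← mul_assoc, mul_self_of_orderOf_eq_two hx, one_mul] at this
  have hfin : Commute x y → False := by
    intro h
    have h2 := orderOf_mul_eq_two hx hy hxy h
    have hm1 : m = 1 := by omega
    have hwxy : w = x * y := by rw [hw, hm1, pow_one]
    have h3 : z ≠ w := fun h => hmem (h ▸ hwm)
    apply h3
    refine hG hx hy hz hwo hxy (fun h => hmem (h ▸ hxm)) (fun h => hmem (h ▸ hym)) ?_ ?_ hzx hzy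
      hwx hwy
    · rw [hwxy]
      exact fun h => ne_one_of_orderOf_eq_two hy (mul_eq_left.mp h)
    · rw [hwxy]
      exact fun h => ne_one_of_orderOf_eq_two hx (mul_eq_right.mp h)
  have hzw : z = w := by
    refine hG hx hy hz hwo hxy (fun h => hmem (h ▸ hxm)) (fun h => hmem (h ▸ hym)) ?_ ?_ hzx hzy
      hwx hwy
    · intro h
      exact hfin (h ▸ hwy)
    · intro h
      exact hfin (h ▸ hwx).symm
  exact hmem (hzw ▸ hwm)

/-- Four generating involutions, with the commutations of a string, none of which lies in the
subgroup generated by the other three. -/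
structure IsStringQuadruple {G : Type*} [Group G] (a b c d : G) : Prop where
  intro ::
  orderOf_a : orderOf a = 2
  orderOf_b : orderOf b = 2
  orderOf_c : orderOf c = 2
  orderOf_d : orderOf d = 2
  comm_ac : Commute a c
  comm_ad : Commute a d
  comm_bd : Commute b d
  a_notMem : a ∉ Subgroup.closure {b, c, d}
  b_notMem : b ∉ Subgroup.closure {a, c, d}
  c_notMem : c ∉ Subgroup.closure {a, b, d}
  d_notMem : d ∉ Subgroup.closure {a, b, c}
  closure_eq_top : Subgroup.closure {a, b, c, d} = ⊤

namespace IsStringQuadruple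

variable {G : Type*} [Group G] {a b c d : G}

lemma symm (h : IsStringQuadruple a b c d) : IsStringQuadruple d c b a where
  orderOf_a := h.orderOf_d
  orderOf_b := h.orderOf_c
  orderOf_c := h.orderOf_b
  orderOf_d := h.orderOf_a
  comm_ac := h.comm_bd.symm
  comm_ad := h.comm_ad.symm
  comm_bd := h.comm_ac.symm
  a_notMem := by
    rw [show ({c, b, a} : Set G) = {a, b, c} by grind]
    exact h.d_notMem
  b_notMem := by
    rw [show ({d, b, a} : Set G) = {a, b, d} by grind]
    exact h.c_notMem
  c_notMem := by
    rw [show ({d, c, a} : Set G) = {a, c, d} by grind]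
    exact h.b_notMem
  d_notMem := by
    rw [show ({d, c, b} : Set G) = {b, c, d} by grind]
    exact h.a_notMem
  closure_eq_top := by
    rw [show ({d, c, b, a} : Set G) = {a, b, c, d} by grind]
    exact h.closure_eq_top

lemma ne_ab (h : IsStringQuadruple a b c d) : a ≠ b :=
  fun e => h.a_notMem (Subgroup.subset_closure (by simp [e]))

lemma ne_ac (h : IsStringQuadruple a b c d) : a ≠ c :=
  fun e => h.a_notMem (Subgroup.subset_closure (by simp [e]))

lemma ne_ad (h : IsStringQuadruple a b c d) : a ≠ d :=
  fun e => h.a_notMem (Subgroup.subset_closure (by simp [e]))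

lemma ne_bc (h : IsStringQuadruple a b c d) : b ≠ c :=
  fun e => h.b_notMem (Subgroup.subset_closure (by simp [e]))

lemma odd_orderOf_mul [Finite G] (h : IsStringQuadruple a b c d) (hG : IsCrossUnique G) :
    Odd (orderOf (a * b)) :=
  hG.odd_orderOf_mul h.orderOf_a h.orderOf_b h.orderOf_d h.ne_ab h.comm_ad.symm h.comm_bd.symm
    fun hd => h.d_notMem (Subgroup.closure_mono (by grind) hd)

lemma not_commute_bc (h : IsStringQuadruple a b c d) (hG : IsCrossUnique G) : ¬ Commute b c :=
  fun hbc => h.symm.ne_ab (hG h.orderOf_a h.orderOf_b h.orderOf_d h.orderOf_c h.ne_ab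
    h.ne_ad.symm h.symm.ne_ac h.ne_ac.symm h.ne_bc.symm h.comm_ad.symm h.comm_bd.symm
    h.comm_ac.symm hbc.symm)

lemma not_commute_ab [Finite G] (h : IsStringQuadruple a b c d) (hG : IsCrossUnique G) :
    ¬ Commute a b := fun hab => by
  have := h.odd_orderOf_mul hG
  rw [orderOf_mul_eq_two h.orderOf_a h.orderOf_b h.ne_ab hab] at this
  exact absurd this (by decide)

end IsStringQuadruple

namespace IsMultiplier

variable {G Ω K : Type*} [Group G] [MulAction G Ω] [Field K] {p : ℕ} {χ : G → Ω → K}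

lemma eq_one_of_sq (hχ : IsMultiplier p χ) (hp : Odd p) {g : G} {x : Ω} (hg : g • x = x)
    (h1 : χ g x = 1) (h2 : g ^ 2 = 1) : g = 1 := by
  obtain ⟨k, rfl⟩ := hp
  have := hχ.pow_eq_one hg h1
  rwa [pow_succ, pow_mul, h2, one_pow, one_mul] at this

lemma eq_neg_one (hχ : IsMultiplier p χ) (hp : Odd p) {g : G} {x : Ω} (hg : g • x = x)
    (h2 : orderOf g = 2) : χ g x = -1 := by
  have h := hχ.map_mul hg hg
  rw [mul_self_of_orderOf_eq_two h2, hχ.map_one] at h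
  refine (mul_self_eq_one_iff.mp h.symm).resolve_left fun h1 => ?_
  exact ne_one_of_orderOf_eq_two h2 (hχ.eq_one_of_sq hp hg h1 (h2 ▸ pow_orderOf_eq_one g))

/-- There is at most one involution fixing two given points. -/
lemma eq_of_fixed (hχ : IsMultiplier p χ) (hp : Odd p) {g h : G} {x y : Ω} (hxy : x ≠ y)
    (hg : orderOf g = 2) (hh : orderOf h = 2) (hgx : g • x = x) (hgy : g • y = y)
    (hhx : h • x = x) (hhy : h • y = y) : g = h := by
  by_contra hne
  have h1 := hχ.map_mul hgx hhx
  rw [hχ.eq_neg_one hp hgx hg, hχ.eq_neg_one hp hhx hh, neg_mul_neg, one_mul] at h1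
  have h2 : g * h ≠ 1 := fun h3 => hne (by
    rw [← inv_of_orderOf_eq_two hh]; exact eq_inv_of_mul_eq_one_left h3)
  exact hxy (hχ.unique_fixed (by rw [mul_smul, hhx, hgx]) h1 h2 (by rw [mul_smul, hhy, hgy])).symm

lemma pow_smul_of_swap {g : G} {x y : Ω} (hx : g • x = y) (hy : g • y = x) {n : ℕ}
    (hn : Odd n) : g ^ n • x = y := by
  obtain ⟨k, rfl⟩ := hn
  induction k with
  | zero => simpa using hx
  | succ k ih =>
    rw [show 2 * (k + 1) + 1 = 1 + 1 + (2 * k + 1) by ring, pow_add, mul_smul, ih, pow_add,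
      mul_smul, pow_one, hy, hx]

end IsMultiplier

namespace IsStringQuadruple

variable {G : Type*} [Group G] {a b c d : G} {Ω K : Type*} [MulAction G Ω] [Field K] {p : ℕ}
  {χ : G → Ω → K}

lemma no_fixed_point (h : IsStringQuadruple a b c d) (hχ : IsMultiplier p χ) (hp : Odd p) {x : Ω}
    (ha : a • x = x) (hc : c • x = x) : False := by
  have h1 := hχ.map_mul ha hc
  rw [hχ.eq_neg_one hp ha h.orderOf_a, hχ.eq_neg_one hp hc h.orderOf_c, neg_mul_neg, one_mul] at h1
  have h2 := orderOf_mul_eq_two h.orderOf_a h.orderOf_c h.ne_ac h.comm_ac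
  exact ne_one_of_orderOf_eq_two h2 (hχ.eq_one_of_sq hp (by rw [mul_smul, hc, ha]) h1
    (h2 ▸ pow_orderOf_eq_one _))

lemma no_fixed_pair [Finite G] (h : IsStringQuadruple a b c d) (hG : IsCrossUnique G)
    (hχ : IsMultiplier p χ) (hp : Odd p) {x y : Ω} (hxy : x ≠ y)
    (hS : ∀ g ∈ ({a, b, c} : Set G), (g • x = x ∧ g • y = y) ∨ (g • x = y ∧ g • y = x)) :
    False := by
  have hord : ∀ {g : G} {u v : Ω}, Odd (orderOf g) → u ≠ v → g • u = v → g • v = u → False :=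
    fun ho huv h1 h2 => huv (by
      have := IsMultiplier.pow_smul_of_swap h1 h2 ho
      rwa [pow_orderOf_eq_one, one_smul] at this)
  have hodd := h.odd_orderOf_mul hG
  have hac := orderOf_mul_eq_two h.orderOf_a h.orderOf_c h.ne_ac h.comm_ac
  have hamem : a ∈ Subgroup.closure {a, b, c} := Subgroup.subset_closure (by simp)
  have hcmem : c ∈ Subgroup.closure {a, b, c} := Subgroup.subset_closure (by simp)
  obtain ⟨ax, ay⟩ | ⟨ax, ay⟩ := hS a (by simp) <;> obtain ⟨bx, by'⟩ | ⟨bx, by'⟩ := hS b (by simp)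
  · exact h.ne_ab (hχ.eq_of_fixed hp hxy h.orderOf_a h.orderOf_b ax ay bx by')
  · exact hord hodd hxy (by rw [mul_smul, bx, ay]) (by rw [mul_smul, by', ax])
  · exact hord hodd hxy (by rw [mul_smul, bx, ax]) (by rw [mul_smul, by', ay])
  · have abx : (a * b) • x = x := by rw [mul_smul, bx, ay]
    have aby : (a * b) • y = y := by rw [mul_smul, by', ax]
    obtain ⟨cx, cy⟩ | ⟨cx, cy⟩ := hS c (by simp)
    · have hb := inv_of_orderOf_eq_two h.orderOf_b
      have h1 : b * c * b⁻¹ = c := by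
        refine hχ.eq_of_fixed hp hxy (by rw [orderOf_conj_eq, h.orderOf_c]) h.orderOf_c ?_ ?_ cx cy
        · rw [hb, mul_smul, bx, mul_smul, cy, by']
        · rw [hb, mul_smul, by', mul_smul, cx, bx]
      exact h.not_commute_bc hG (mul_inv_eq_iff_eq_mul.mp h1)
    · have hacx : (a * c) • x = x := by rw [mul_smul, cx, ay]
      have hacy : (a * c) • y = y := by rw [mul_smul, cy, ax]
      have hd : Commute d (a * b) := h.comm_ad.symm.mul_right h.comm_bd.symm
      have hab1 : a * b ≠ 1 := fun h1 => h.ne_ab (by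
        rw [← inv_of_orderOf_eq_two h.orderOf_b]; exact eq_inv_of_mul_eq_one_left h1)
      have hχ1 : χ (a * b) x ≠ 1 := fun h1 => hxy (hχ.unique_fixed abx h1 hab1 aby).symm
      obtain ⟨y', hy', -, hfix⟩ := hχ.exists_other abx hχ1
      obtain rfl : y = y' := (hfix y aby).resolve_left hxy.symm
      have hdx := hfix (d • x) (by rw [← mul_smul, ← hd.eq, mul_smul, abx])
      have hdy := hfix (d • y) (by rw [← mul_smul, ← hd.eq, mul_smul, aby])
      rcases hdx with hdx | hdx
      · have hdy' : d • y = y := hdy.resolve_left fun e => hxy (smul_left_cancel d (hdx.trans e.symm))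
        have := hχ.eq_of_fixed hp hxy h.orderOf_d hac hdx hdy' hacx hacy
        exact h.d_notMem (this ▸ mul_mem hamem hcmem)
      · have hdy' : d • y = x := hdy.resolve_right fun e => hxy (smul_left_cancel d (hdx.trans e.symm))
        have := hχ.eq_of_fixed hp hxy
          (orderOf_mul_eq_two h.orderOf_a h.orderOf_d h.ne_ad h.comm_ad) hac
          (by rw [mul_smul, hdx, ay]) (by rw [mul_smul, hdy', ax]) hacx hacy
        exact h.symm.ne_ab (mul_left_cancel this)

lemma three_le_card_orbit [Finite G] (h : IsStringQuadruple a b c d) (hG : IsCrossUnique G)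
    (hχ : IsMultiplier p χ) (hp : Odd p) (x : Ω) :
    3 ≤ Nat.card (MulAction.orbit (Subgroup.closure {a, b, c}) x) := by
  set H := Subgroup.closure {a, b, c}
  have hmem : ∀ g ∈ ({a, b, c} : Set G), g ∈ H := fun g hg => Subgroup.subset_closure hg
  by_contra hlt
  have hfin : (MulAction.orbit H x).Finite := Set.finite_range _
  obtain ⟨y, hy⟩ : ∃ y, MulAction.orbit H x ⊆ {x, y} := by
    by_contra! hcon
    obtain ⟨y, hy, hyx⟩ : ∃ y ∈ MulAction.orbit H x, y ≠ x := by
      obtain ⟨y, hy, hyx⟩ := Set.not_subset.mp (hcon x)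
      exact ⟨y, hy, by simpa using hyx⟩
    obtain ⟨z, hz, hzxy⟩ := Set.not_subset.mp (hcon y)
    have : ({x, y, z} : Set Ω) ⊆ MulAction.orbit H x := by
      rintro w (rfl | rfl | rfl)
      · exact MulAction.mem_orbit_self _
      · exact hy
      · exact hz
    have h3 := Set.ncard_le_ncard this hfin
    rw [Set.ncard_eq_three.mpr ⟨x, y, z, hyx.symm, by grind, by grind, rfl⟩] at h3
    exact hlt h3
  by_cases hall : ∀ g ∈ ({a, b, c} : Set G), g • x = x
  · exact h.no_fixed_point hχ hp (hall a (by simp)) (hall c (by simp))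
  · push Not at hall
    obtain ⟨g, hg, hgx⟩ := hall
    have hgy : g • x = y := by
      have : g • x ∈ ({x, y} : Set Ω) := hy ⟨⟨g, hmem g hg⟩, rfl⟩
      exact this.resolve_left hgx
    have hxy : x ≠ y := fun e => hgx (hgy.trans e.symm)
    refine h.no_fixed_pair hG hχ hp hxy fun k hk => ?_
    have hkx : k • x ∈ ({x, y} : Set Ω) := hy ⟨⟨k, hmem k hk⟩, rfl⟩
    have hky : k • y ∈ ({x, y} : Set Ω) := by
      have : k • g • x ∈ ({x, y} : Set Ω) :=
        hy ⟨⟨k, hmem k hk⟩ * ⟨g, hmem g hg⟩, mul_smul k g x⟩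
      rwa [hgy] at this
    rcases hkx with hkx | hkx <;> rcases hky with hky | hky
    · exact absurd (smul_left_cancel k (hkx.trans hky.symm)) hxy
    · exact Or.inl ⟨hkx, hky⟩
    · exact Or.inr ⟨hkx, hky⟩
    · exact absurd (smul_left_cancel k (hkx.trans hky.symm)) hxy

lemma map_eq_of_odd {δ : G →* ℤˣ} {u v : G} (h : Odd (orderOf (u * v))) : δ u = δ v := by
  have h1 : δ (u * v) ^ orderOf (u * v) = 1 := by rw [← map_pow, pow_orderOf_eq_one, map_one]
  obtain ⟨k, hk⟩ := h
  rw [hk, pow_succ, pow_mul, Int.units_sq, one_pow, one_mul, map_mul] at h1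
  rw [eq_inv_of_mul_eq_one_left h1, Int.units_inv_eq_self]

lemma orderOf_le_four_or [Finite G] [Finite Ω] [Fact p.Prime] [CharP K p]
    (h : IsStringQuadruple a b c d) (hG : IsCrossUnique G)
    (hχ : IsMultiplier p χ) (hp : p ≠ 2) {δ : G →* ℤˣ} (hδ : δ ≠ 1) :
    (∀ g ∈ Subgroup.closure {a, b, c}, orderOf g ≤ 4) ∨
    (∃ m, 1 < p ^ m ∧
      p ^ m * ((p ^ m - 1) * (p ^ m + 1)) ≤ 2 * Nat.card (Subgroup.closure {a, b, c}) ∧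
      ∀ g ∈ Subgroup.closure {a, b, c}, ∀ x : Ω, g • x = x →
        χ g x ^ (p ^ m - 1) = 1 ∨ χ g x ^ (p ^ m + 1) = 1) := by
  have hpo : Odd p := (Fact.out : p.Prime).odd_of_ne_two hp
  set H := Subgroup.closure {a, b, c} with hH
  rcases (hχ.subgroup H).classification hp (h.three_le_card_orbit hG hχ hpo) with h1 | h1 |
    ⟨m, hm1, hm, h1⟩
  · left
    intro g hg
    simpa using h1 ⟨g, hg⟩
  · exfalso
    have ha : a ∈ H := Subgroup.subset_closure (by simp)
    have hb : b ∈ H := Subgroup.subset_closure (by simp)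
    have hc : c ∈ H := Subgroup.subset_closure (by simp)
    have hconj : ∀ u ∈ H, ∀ v ∈ H, orderOf u = 2 → orderOf v = 2 → δ u = δ v := by
      intro u hu v hv hu2 hv2
      have := h1 ⟨u, hu⟩ ⟨v, hv⟩ (by rwa [Subgroup.orderOf_mk]) (by rwa [Subgroup.orderOf_mk])
      exact isConj_iff_eq.mp ((δ.comp H.subtype).map_isConj this)
    have hac := orderOf_mul_eq_two h.orderOf_a h.orderOf_c h.ne_ac h.comm_ac
    have h2 := hconj _ (mul_mem ha hc) _ ha hac h.orderOf_a
    have h3 := hconj _ (mul_mem ha hc) _ hc hac h.orderOf_c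
    rw [map_mul] at h2 h3
    have hδc : δ c = 1 := mul_eq_left.mp h2
    have hδa : δ a = 1 := mul_eq_right.mp h3
    have hδb : δ b = 1 := (hconj b hb a ha h.orderOf_b h.orderOf_a).trans hδa
    have hδd : δ d = 1 := (map_eq_of_odd (h.symm.odd_orderOf_mul hG)).trans hδc
    apply hδ
    rw [← MonoidHom.ker_eq_top_iff, eq_top_iff, ← h.closure_eq_top, Subgroup.closure_le]
    rintro _ (rfl | rfl | rfl | rfl) <;> assumption
  · exact Or.inr ⟨m, hm1, hm, fun g hg x hx => h1 ⟨g, hg⟩ x hx⟩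

/-- The subgroup generated by the first three involutions has index greater than two. -/
lemma two_mul_card_lt [Finite G] (h : IsStringQuadruple a b c d) (hG : IsCrossUnique G) :
    2 * Nat.card (Subgroup.closure {a, b, c}) < Nat.card G := by
  set H := Subgroup.closure {a, b, c} with hH
  have hc : c ∈ H := Subgroup.subset_closure (by simp)
  by_contra! hle
  rw [← H.card_mul_index, mul_comm 2] at hle
  have hi := Nat.le_of_mul_le_mul_left hle Nat.card_pos
  have hsq : (d * c) ^ 2 ∈ H := by
    have : H.index ≠ 0 := Subgroup.index_ne_zero_of_finite
    obtain h1 | h2 : H.index = 1 ∨ H.index = 2 := by omega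
    · rw [Subgroup.index_eq_one.mp h1]; trivial
    · exact Subgroup.sq_mem_of_index_two h2 _
  obtain ⟨k, hk⟩ := h.symm.odd_orderOf_mul hG
  have : d * c = (((d * c) ^ 2) ^ k)⁻¹ := by
    rw [eq_inv_iff_mul_eq_one, ← pow_mul, ← pow_succ', ← hk, pow_orderOf_eq_one]
  have hdc : d * c ∈ H := this ▸ inv_mem (pow_mem hsq k)
  exact h.d_notMem ((H.mul_mem_cancel_right hc).mp hdc)

end IsStringQuadruple

namespace ProjectiveGeneralLinearGroup

open Matrix

variable {F : Type*} [Field F]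

lemma mk_eq_mk_of_eq_smul {u w : GL (Fin 2) F} {c : F}
    (h : (u : Matrix (Fin 2) (Fin 2) F) = c • (w : Matrix (Fin 2) (Fin 2) F)) : mk u = mk w := by
  refine mk_eq_mk_iff.mpr ⟨c, ?_, h⟩
  rintro rfl
  apply det_ne_zero u
  rw [h, zero_smul, Matrix.det_zero]

lemma trace_eq_zero {u : GL (Fin 2) F} (hu : orderOf (mk u) = 2) :
    (u : Matrix (Fin 2) (Fin 2) F).trace = 0 := by
  have h1 : mk (u * u) = 1 := mul_self_of_orderOf_eq_two hu
  have h2 : mk u ≠ 1 := ne_one_of_orderOf_eq_two hu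
  rw [mk_eq_one_iff] at h1
  rw [Ne, mk_eq_one_iff] at h2
  simp only [Units.val_mul, Matrix.mul_apply, Fin.sum_univ_two] at h1
  rw [Matrix.trace_fin_two]
  by_contra ht
  apply h2
  obtain ⟨h3, h4, h5⟩ := h1
  refine ⟨mul_right_cancel₀ ht ?_, mul_right_cancel₀ ht ?_, mul_right_cancel₀ ht ?_⟩
  · linear_combination h3
  · linear_combination h4
  · linear_combination h5

lemma apply_one_one {u : GL (Fin 2) F} (hu : orderOf (mk u) = 2) : u 1 1 = -u 0 0 := by
  have := trace_eq_zero hu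
  rw [Matrix.trace_fin_two] at this
  linear_combination this

lemma trace_mul_eq {u w : GL (Fin 2) F} (hu : orderOf (mk u) = 2) (hw : orderOf (mk w) = 2) :
    ((u : Matrix (Fin 2) (Fin 2) F) * (w : Matrix (Fin 2) (Fin 2) F)).trace =
      2 * u 0 0 * w 0 0 + u 0 1 * w 1 0 + u 1 0 * w 0 1 := by
  rw [Matrix.trace_fin_two]
  simp only [Matrix.mul_apply, Fin.sum_univ_two, apply_one_one hu, apply_one_one hw]
  ring

lemma mul_add_mul {u w : GL (Fin 2) F} (hu : orderOf (mk u) = 2) (hw : orderOf (mk w) = 2) :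
    (u : Matrix (Fin 2) (Fin 2) F) * (w : Matrix (Fin 2) (Fin 2) F) +
      (w : Matrix (Fin 2) (Fin 2) F) * (u : Matrix (Fin 2) (Fin 2) F) =
      ((u : Matrix (Fin 2) (Fin 2) F) * (w : Matrix (Fin 2) (Fin 2) F)).trace • 1 := by
  rw [trace_mul_eq hu hw]
  ext i j
  fin_cases i <;> fin_cases j <;>
    simp [Matrix.mul_apply, Fin.sum_univ_two, apply_one_one hu, apply_one_one hw] <;> ring

lemma commute_of_trace_eq_zero {u w : GL (Fin 2) F} (hu : orderOf (mk u) = 2)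
    (hw : orderOf (mk w) = 2)
    (h : ((u : Matrix (Fin 2) (Fin 2) F) * (w : Matrix (Fin 2) (Fin 2) F)).trace = 0) :
    Commute (mk u) (mk w) := by
  have h1 := mul_add_mul hu hw
  rw [h, zero_smul, add_eq_zero_iff_eq_neg] at h1
  exact mk_eq_mk_of_eq_smul (u := u * w) (w := w * u) (c := -1) (by simpa using h1)

lemma trace_eq_zero_of_commute {u w : GL (Fin 2) F} (hu : orderOf (mk u) = 2)
    (hw : orderOf (mk w) = 2) (hne : mk u ≠ mk w) (h : Commute (mk u) (mk w)) :
    ((u : Matrix (Fin 2) (Fin 2) F) * (w : Matrix (Fin 2) (Fin 2) F)).trace = 0 := by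
  have h1 := mul_add_mul hu hw
  obtain ⟨c, hc, h2⟩ := mk_eq_mk_iff.mp (h.eq : mk (u * w) = mk (w * u))
  simp only [Units.val_mul] at h2
  set s := ((u : Matrix (Fin 2) (Fin 2) F) * (w : Matrix (Fin 2) (Fin 2) F)).trace
  by_contra hs
  rw [h2] at h1
  nth_rw 2 [← one_smul F ((w : Matrix (Fin 2) (Fin 2) F) * (u : Matrix (Fin 2) (Fin 2) F))] at h1
  rw [← add_smul] at h1
  have hc1 : c + 1 ≠ 0 := by
    intro h0
    rw [h0, zero_smul] at h1
    have := congrFun₂ h1 0 0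
    simp only [Matrix.zero_apply, Matrix.smul_apply, Matrix.one_apply_eq, smul_eq_mul, mul_one] at this
    exact hs this.symm
  have h3 : mk (w * u) = mk 1 := mk_eq_mk_of_eq_smul (c := s / (c + 1)) (by
    rw [div_eq_inv_mul, mul_smul, Units.val_one, ← h1, smul_smul, inv_mul_cancel₀ hc1, one_smul,
      Units.val_mul])
  have h4 : mk w * mk u = 1 := h3
  rw [← inv_of_orderOf_eq_two hu] at hne
  exact hne (inv_eq_of_mul_eq_one_left h4)

lemma exists_smul_of_cross_eq_zero {x y : Fin 3 → F} (hx : x ≠ 0)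
    (h : crossProduct x y = 0) : ∃ k : F, y = k • x := by
  have h0 : x 1 * y 2 - x 2 * y 1 = 0 := by simpa [cross_apply] using congrFun h 0
  have h1 : x 2 * y 0 - x 0 * y 2 = 0 := by simpa [cross_apply] using congrFun h 1
  have h2 : x 0 * y 1 - x 1 * y 0 = 0 := by simpa [cross_apply] using congrFun h 2
  obtain ⟨i, hi⟩ := Function.ne_iff.mp hx
  refine ⟨y i / x i, ?_⟩
  ext j
  simp only [Pi.smul_apply, smul_eq_mul, Pi.zero_apply] at hi ⊢
  fin_cases i <;> fin_cases j <;> simp only [Fin.zero_eta, Fin.mk_one, Fin.reduceFinMk] at hi ⊢ <;>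
    field_simp <;> grind

lemma exists_smul_of_dot_eq_zero {x y u v : Fin 3 → F} (hxy : crossProduct x y ≠ 0)
    (hu : u ≠ 0) (hux : x ⬝ᵥ u = 0) (huy : y ⬝ᵥ u = 0) (hvx : x ⬝ᵥ v = 0) (hvy : y ⬝ᵥ v = 0) :
    ∃ k : F, v = k • u := by
  have key : ∀ z : Fin 3 → F, x ⬝ᵥ z = 0 → y ⬝ᵥ z = 0 → ∃ k : F, z = k • crossProduct x y := by
    intro z hxz hyz
    apply exists_smul_of_cross_eq_zero hxy
    simp only [dotProduct, Fin.sum_univ_three] at hxz hyz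
    ext i
    fin_cases i <;> simp [cross_apply] <;> grind
  obtain ⟨k, hk⟩ := key u hux huy
  obtain ⟨l, hl⟩ := key v hvx hvy
  have hk0 : k ≠ 0 := by
    rintro rfl
    exact hu (by rw [hk, zero_smul])
  exact ⟨l / k, by rw [hk, smul_smul, div_mul_cancel₀ _ hk0, hl]⟩

theorem isCrossUnique (h2 : (2 : F) ≠ 0) :
    IsCrossUnique (ProjectiveGeneralLinearGroup (Fin 2) F) := by
  intro x y u v hx hy hu hv hxy hux huy hvx hvy cux cuy cvx cvy
  induction x using QuotientGroup.induction_on with | H x =>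
  induction y using QuotientGroup.induction_on with | H y =>
  induction u using QuotientGroup.induction_on with | H u =>
  induction v using QuotientGroup.induction_on with | H v =>
  have e1 := trace_eq_zero_of_commute hu hx hux cux
  have e2 := trace_eq_zero_of_commute hu hy huy cuy
  have e3 := trace_eq_zero_of_commute hv hx hvx cvx
  have e4 := trace_eq_zero_of_commute hv hy hvy cvy
  rw [trace_mul_eq hu hx] at e1
  rw [trace_mul_eq hu hy] at e2
  rw [trace_mul_eq hv hx] at e3
  rw [trace_mul_eq hv hy] at e4
  have hnz : ∀ {w : GL (Fin 2) F}, orderOf (mk w) = 2 → w 0 0 = 0 → w 0 1 = 0 → w 1 0 = 0 →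
      False := by
    intro w hw h1 h2 h3
    apply det_ne_zero w
    rw [Matrix.det_fin_two, h1, h2]
    ring
  have hsmul : ∀ {w z : GL (Fin 2) F}, orderOf (mk w) = 2 → orderOf (mk z) = 2 → ∀ k : F,
      w 0 0 = k * z 0 0 → w 0 1 = k * z 0 1 → w 1 0 = k * z 1 0 → mk w = mk z := by
    intro w z hw hz k h1 h2 h3
    refine mk_eq_mk_of_eq_smul (c := k) ?_
    ext i j
    fin_cases i <;> fin_cases j <;>
      simp [h1, h2, h3, apply_one_one hw, apply_one_one hz]
  have hcross : crossProduct ![x 0 0, x 0 1, x 1 0] ![y 0 0, y 0 1, y 1 0] ≠ 0 := by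
    intro h0
    obtain ⟨k, hk⟩ := exists_smul_of_cross_eq_zero
      (fun h => hnz hx (congrFun h 0) (congrFun h 1) (congrFun h 2)) h0
    exact hxy (hsmul hy hx k (by simpa using congrFun hk 0) (by simpa using congrFun hk 1)
      (by simpa using congrFun hk 2)).symm
  obtain ⟨k, hk⟩ := exists_smul_of_dot_eq_zero (u := ![2 * v 0 0, v 1 0, v 0 1])
    (v := ![2 * u 0 0, u 1 0, u 0 1]) hcross
    (fun h => hnz hv (by simpa [h2] using congrFun h 0) (congrFun h 2) (congrFun h 1))
    (by simp [dotProduct, Fin.sum_univ_three]; linear_combination e3)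
    (by simp [dotProduct, Fin.sum_univ_three]; linear_combination e4)
    (by simp [dotProduct, Fin.sum_univ_three]; linear_combination e1)
    (by simp [dotProduct, Fin.sum_univ_three]; linear_combination e2)
  refine hsmul hu hv k (mul_left_cancel₀ h2 ?_) (by simpa using congrFun hk 2)
    (by simpa using congrFun hk 1)
  have : 2 * u 0 0 = k * (2 * v 0 0) := by simpa using congrFun hk 0
  linear_combination this

lemma commute_trans_of_char_two (h2 : (2 : F) = 0)
    {x y z : ProjectiveGeneralLinearGroup (Fin 2) F} (hx : orderOf x = 2) (hy : orderOf y = 2)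
    (hz : orderOf z = 2) (hxy : Commute x y) (hyz : Commute y z) : Commute x z := by
  by_cases hne : x = y
  · exact hne ▸ hyz
  by_cases hne' : y = z
  · exact hne' ▸ hxy
  induction x using QuotientGroup.induction_on with | H x =>
  induction y using QuotientGroup.induction_on with | H y =>
  induction z using QuotientGroup.induction_on with | H z =>
  have e1 := trace_eq_zero_of_commute hx hy hne hxy
  have e2 := trace_eq_zero_of_commute hy hz hne' hyz
  rw [trace_mul_eq hx hy, h2] at e1
  rw [trace_mul_eq hy hz, h2] at e2
  apply commute_of_trace_eq_zero hx hz
  rw [trace_mul_eq hx hz, h2]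
  have hy1 : ¬ (y 0 1 = 0 ∧ y 1 0 = 0) := fun h =>
    ne_one_of_orderOf_eq_two hy (mk_eq_one_iff.mpr ⟨h.1, h.2, by
      rw [apply_one_one hy]; linear_combination y 0 0 * h2⟩)
  by_cases h01 : y 0 1 = 0
  · have h10 : y 1 0 ≠ 0 := fun h => hy1 ⟨h01, h⟩
    apply mul_right_cancel₀ h10
    linear_combination z 1 0 * e1 + x 1 0 * e2 - z 1 0 * x 1 0 * y 0 1 * h2
  · apply mul_right_cancel₀ h01
    linear_combination z 0 1 * e1 + x 0 1 * e2 - z 0 1 * x 0 1 * y 1 0 * h2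

lemma exists_not_commute : ∃ g h : ProjectiveGeneralLinearGroup (Fin 2) F, ¬ Commute g h := by
  refine ⟨mk (GeneralLinearGroup.mkOfDetNeZero !![1, 1; 0, 1] (by simp)),
    mk (GeneralLinearGroup.mkOfDetNeZero !![1, 0; 1, 1] (by simp)), fun h => ?_⟩
  obtain ⟨c, -, hc⟩ := mk_eq_mk_iff.mp h.eq
  have h01 := congrFun₂ hc 0 1
  have h00 := congrFun₂ hc 0 0
  simp [GeneralLinearGroup.mkOfDetNeZero, Matrix.mul_apply, Fin.sum_univ_two] at h01 h00
  rw [← h01] at h00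
  simp at h00

end ProjectiveGeneralLinearGroup

namespace ProjectiveGeneralLinearGroup

open Matrix Polynomial
open scoped LinearAlgebra.Projectivization

variable {F : Type*} [Field F]

lemma exists_finite_splits.{u} {F : Type u} [Field F] [Finite F] (f : F[X]) :
    ∃ (K : Type u) (_ : Field K) (_ : Algebra F K), Finite K ∧ (f.map (algebraMap F K)).Splits :=
  ⟨f.SplittingField, inferInstance, inferInstance, inferInstance, SplittingField.splits f⟩

lemma exists_finite_extension.{u} (F : Type u) [Field F] [Finite F] :
    ∃ (K : Type u) (_ : Field K) (_ : Algebra F K), Finite K ∧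
      ∀ b c : F, ∃ a : K, a ^ 2 - algebraMap F K b * a + algebraMap F K c = 0 := by
  have := Fintype.ofFinite F
  have hdeg : ∀ b c : F, (X ^ 2 - C b * X + C c : F[X]).degree = 2 := fun b c => by
    compute_degree!
  have hne : ∀ b c : F, (X ^ 2 - C b * X + C c : F[X]) ≠ 0 := fun b c h => by
    have := hdeg b c
    simp [h] at this
  obtain ⟨f, hf0, hf⟩ : ∃ f : F[X], f ≠ 0 ∧ ∀ z : F × F, (X ^ 2 - C z.1 * X + C z.2 : F[X]) ∣ f := by
    generalize hP : (fun z : F × F => (X ^ 2 - C z.1 * X + C z.2 : F[X])) = P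
    refine ⟨∏ z, P z, Finset.prod_ne_zero_iff.mpr fun z _ => ?_, fun z => ?_⟩
    · rw [← hP]
      exact hne z.1 z.2
    · rw [congrFun hP z]
      exact Finset.dvd_prod_of_mem P (Finset.mem_univ z)
  obtain ⟨K, _, _, hK, hs⟩ := exists_finite_splits f
  refine ⟨K, inferInstance, inferInstance, hK, fun b c => ?_⟩
  have hg := hs.of_dvd ((Polynomial.map_ne_zero_iff (algebraMap F K).injective).mpr hf0)
    (Polynomial.map_dvd _ (hf (b, c)))
  obtain ⟨a, ha⟩ := hg.exists_eval_eq_zero (by rw [degree_map, hdeg]; decide)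
  exact ⟨a, by simpa using ha⟩

lemma card_le (F : Type*) [Field F] [Fintype F] :
    Nat.card (ProjectiveGeneralLinearGroup (Fin 2) F) ≤
      Fintype.card F * ((Fintype.card F - 1) * (Fintype.card F + 1)) := by
  classical
  set q := Fintype.card F with hq
  have hq1 : 1 < q := Fintype.one_lt_card
  have h1 := Subgroup.card_eq_card_quotient_mul_card_subgroup
    (Subgroup.center (GL (Fin 2) F))
  rw [Matrix.card_GL_field, Fin.prod_univ_two] at h1
  have h2 : q - 1 ≤ Nat.card (Subgroup.center (GL (Fin 2) F)) := by
    rw [hq, ← Fintype.card_units, ← Nat.card_eq_fintype_card]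
    refine Nat.card_le_card_of_injective (fun c : Fˣ => ⟨GeneralLinearGroup.scalar (Fin 2) c,
      GeneralLinearGroup.center_eq_range_scalar.ge ⟨c, rfl⟩⟩) fun c c' h => ?_
    have := congrArg (fun u : Subgroup.center (GL (Fin 2) F) => (u : GL (Fin 2) F) 0 0) h
    ext
    simpa using this
  have h3 := Nat.mul_le_mul_left (Nat.card (ProjectiveGeneralLinearGroup (Fin 2) F)) h2
  rw [← h1, ← hq] at h3
  refine Nat.le_of_mul_le_mul_right (h3.trans (le_of_eq ?_)) (by omega : 0 < q - 1)
  obtain ⟨r, hr⟩ : ∃ r, q = r + 1 := ⟨q - 1, by omega⟩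
  rw [hr]
  have e1 : (r + 1) ^ 2 - (r + 1) ^ ((0 : Fin 2) : ℕ) = r * (r + 2) := by
    rw [Nat.sub_eq_iff_eq_add (Nat.pow_le_pow_right (by omega) (by simp))]
    simp only [Fin.val_zero, pow_zero]
    ring
  have e2 : (r + 1) ^ 2 - (r + 1) ^ ((1 : Fin 2) : ℕ) = r * (r + 1) := by
    rw [Nat.sub_eq_iff_eq_add (Nat.pow_le_pow_right (by omega) (by simp))]
    simp only [Fin.val_one, pow_one]
    ring
  rw [e1, e2]
  simp only [Nat.add_sub_cancel]
  ring

lemma exists_hom_ne_one (F : Type*) [Field F] [Fintype F] (h2 : (2 : F) ≠ 0) :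
    ∃ δ : ProjectiveGeneralLinearGroup (Fin 2) F →* ℤˣ, δ ≠ 1 := by
  classical
  let δ : GL (Fin 2) F →* ℤˣ :=
    (Units.map (quadraticChar F).toMonoidHom).comp GeneralLinearGroup.det
  have hδ : ∀ u ∈ Subgroup.center (GL (Fin 2) F), δ u = 1 := by
    intro u hu
    obtain ⟨c, rfl⟩ := GeneralLinearGroup.center_eq_range_scalar.le hu
    ext
    simp only [δ, MonoidHom.comp_apply, Units.coe_map, GeneralLinearGroup.val_det_apply]
    simpa using quadraticChar_sq_one' c.ne_zero
  have hF : ringChar F ≠ 2 := fun h => h2 (by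
    have := ringChar.Nat.cast_ringChar (R := F)
    rw [h] at this
    exact_mod_cast this)
  obtain ⟨a, ha⟩ := quadraticChar_exists_neg_one hF
  have ha0 : a ≠ 0 := by
    rintro rfl
    simp at ha
  refine ⟨QuotientGroup.lift _ δ hδ, fun h => ?_⟩
  have h1 := congrArg Units.val (DFunLike.congr_fun h
    (mk (GeneralLinearGroup.mkOfDetNeZero !![a, 0; 0, 1] (by simpa using ha0))))
  change quadraticChar F (!![a, 0; 0, 1] : Matrix (Fin 2) (Fin 2) F).det = 1 at h1
  rw [Matrix.det_fin_two_of, mul_one, mul_zero, sub_zero, ha] at h1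
  norm_num at h1

lemma sq_eq (u : GL (Fin 2) F) : (u : Matrix (Fin 2) (Fin 2) F) ^ 2 =
    (u : Matrix (Fin 2) (Fin 2) F).trace • (u : Matrix (Fin 2) (Fin 2) F) -
      (u : Matrix (Fin 2) (Fin 2) F).det • 1 := by
  rw [Matrix.trace_fin_two, Matrix.det_fin_two]
  ext i j
  fin_cases i <;> fin_cases j <;> simp [sq, Matrix.mul_apply, Fin.sum_univ_two] <;> ring

lemma eq_zero_of_mk_eq_one {u w : GL (Fin 2) F} {r s : F} (hu : mk u ≠ 1) (hw : mk w = 1)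
    (h : (w : Matrix (Fin 2) (Fin 2) F) = r • (u : Matrix (Fin 2) (Fin 2) F) + s • 1) : r = 0 := by
  rw [Ne, mk_eq_one_iff] at hu
  rw [mk_eq_one_iff, h] at hw
  simp at hw
  grind

lemma trace_sq_of_orderOf_eq_three {u : GL (Fin 2) F} (hu : orderOf (mk u) = 3) :
    (u : Matrix (Fin 2) (Fin 2) F).trace ^ 2 = (u : Matrix (Fin 2) (Fin 2) F).det := by
  set t := (u : Matrix (Fin 2) (Fin 2) F).trace with ht
  set d := (u : Matrix (Fin 2) (Fin 2) F).det with hd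
  have h1 : mk u ≠ 1 := fun h => by simp [h] at hu
  have h3 : mk (u ^ 3) = 1 := by
    have := pow_orderOf_eq_one (mk u)
    rwa [hu] at this
  refine sub_eq_zero.mp (eq_zero_of_mk_eq_one (s := - t * d) h1 h3 ?_)
  rw [Units.val_pow_eq_pow_val, pow_succ, sq_eq, ← ht, ← hd, sub_mul, smul_mul_assoc, ← sq, sq_eq,
    ← ht, ← hd, smul_mul_assoc, one_mul]
  module

lemma trace_sq_of_orderOf_eq_four {u : GL (Fin 2) F} (hu : orderOf (mk u) = 4) :
    (u : Matrix (Fin 2) (Fin 2) F).trace ^ 2 = 2 * (u : Matrix (Fin 2) (Fin 2) F).det := by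
  set t := (u : Matrix (Fin 2) (Fin 2) F).trace with ht
  set d := (u : Matrix (Fin 2) (Fin 2) F).det with hd
  have h1 : mk u ≠ 1 := fun h => by simp [h] at hu
  have h4 : mk (u ^ 4) = 1 := by
    have := pow_orderOf_eq_one (mk u)
    rwa [hu] at this
  have h2 : mk (u ^ 2) ≠ 1 := fun h => by
    have := orderOf_dvd_of_pow_eq_one (x := mk u) (n := 2) h
    rw [hu] at this
    norm_num at this
  have ht0 : t ≠ 0 := by
    intro h0
    apply h2
    refine mk_eq_mk_of_eq_smul (w := 1) (c := -d) ?_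
    rw [Units.val_pow_eq_pow_val, sq_eq, ← ht, ← hd, h0, Units.val_one]
    module
  have key := eq_zero_of_mk_eq_one (r := t * (t ^ 2 - 2 * d)) (s := d ^ 2 - t ^ 2 * d) h1 h4 (by
    rw [Units.val_pow_eq_pow_val, show (4 : ℕ) = 2 + 2 from rfl, pow_add, sq_eq, ← ht, ← hd,
      sub_mul, mul_sub, mul_sub, smul_mul_smul_comm, ← sq, ← sq, sq_eq, ← ht, ← hd]
    simp only [smul_mul_assoc, mul_smul_comm, one_mul, mul_one]
    module)
  linear_combination (mul_eq_zero.mp key).resolve_left ht0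

end ProjectiveGeneralLinearGroup

namespace ProjectiveGeneralLinearGroup

open Matrix

variable {F : Type*} [Field F]

lemma conj_eq_of_mk_eq {u w : GL (Fin 2) F} (h : mk u = mk w) (V : Matrix (Fin 2) (Fin 2) F) :
    (u : Matrix (Fin 2) (Fin 2) F) * V * (u⁻¹ : GL (Fin 2) F) =
      (w : Matrix (Fin 2) (Fin 2) F) * V * (w⁻¹ : GL (Fin 2) F) := by
  obtain ⟨c, hc, huw⟩ := mk_eq_mk_iff.mp h
  have hinv : ((u⁻¹ : GL (Fin 2) F) : Matrix (Fin 2) (Fin 2) F) =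
      c⁻¹ • ((w⁻¹ : GL (Fin 2) F) : Matrix (Fin 2) (Fin 2) F) := by
    rw [← mul_one ((u⁻¹ : GL (Fin 2) F) : Matrix (Fin 2) (Fin 2) F), Units.inv_mul_eq_iff_eq_mul,
      huw, smul_mul_smul_comm, mul_inv_cancel₀ hc, one_smul, Units.mul_inv]
  rw [hinv, huw]
  simp [smul_smul, hc]

/-- Conjugation by an involution acts on traceless matrices as minus a reflection. -/
lemma conj_eq_reflection {u : GL (Fin 2) F} (hu : orderOf (mk u) = 2)
    {V : Matrix (Fin 2) (Fin 2) F} (hV : V.trace = 0) :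
    (u : Matrix (Fin 2) (Fin 2) F) * V * (u⁻¹ : GL (Fin 2) F) =
      -V - (((u : Matrix (Fin 2) (Fin 2) F) * V).trace / (u : Matrix (Fin 2) (Fin 2) F).det) •
        (u : Matrix (Fin 2) (Fin 2) F) := by
  have hd := det_ne_zero u
  have h11 : V 1 1 = - V 0 0 := by
    rw [Matrix.trace_fin_two] at hV
    linear_combination hV
  rw [Units.mul_inv_eq_iff_eq_mul, sub_mul, smul_mul_assoc, ← sq, sq_eq, trace_eq_zero hu,
    zero_smul, zero_sub, smul_neg, smul_smul, div_mul_cancel₀ _ hd, Matrix.trace_fin_two]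
  ext i j
  fin_cases i <;> fin_cases j <;>
    simp [Matrix.mul_apply, Fin.sum_univ_two, apply_one_one hu, h11] <;> ring

/-- A subfield containing the suitably rescaled trace forms of a family of involutions
generating `PGL(2, F)` contains all normalised traces of products of conjugates. -/
lemma trace_conj_mem [Finite F] {ι : Type*} (h2 : (2 : F) ≠ 0) {A : ι → GL (Fin 2) F}
    (hA : ∀ i, orderOf (mk (A i)) = 2)
    (hgen : Subgroup.closure (Set.range fun i => mk (A i)) = ⊤) {k : Subfield F} {c : ι → F}
    (hc : ∀ i, c i ≠ 0) {e : F} (he : e ≠ 0)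
    (hk : ∀ i j, c i * c j * ((A i : Matrix (Fin 2) (Fin 2) F) *
      (A j : Matrix (Fin 2) (Fin 2) F)).trace / e ∈ k) (i : ι) (g : GL (Fin 2) F) :
    ((A i : Matrix (Fin 2) (Fin 2) F) * ((g : Matrix (Fin 2) (Fin 2) F) *
      (A i : Matrix (Fin 2) (Fin 2) F) * (g⁻¹ : GL (Fin 2) F))).trace /
        (A i : Matrix (Fin 2) (Fin 2) F).det ∈ k := by
  have hk2 : (2 : F) ∈ k := ofNat_mem k 2
  let w : ι → Matrix (Fin 2) (Fin 2) F := fun i => c i • (A i : Matrix (Fin 2) (Fin 2) F)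
  let L : Submodule k (Matrix (Fin 2) (Fin 2) F) := Submodule.span k (Set.range w)
  have hwL : ∀ i, w i ∈ L := fun i => Submodule.subset_span ⟨i, rfl⟩
  have htr : ∀ V ∈ L, V.trace = 0 := by
    intro V hV
    induction hV using Submodule.span_induction with
    | mem V hV => obtain ⟨j, rfl⟩ := hV; simp [w, trace_eq_zero (hA j)]
    | zero => simp
    | add U V _ _ hU hV => rw [Matrix.trace_add, hU, hV, add_zero]
    | smul r V _ hV => rw [Matrix.trace_smul, hV, smul_zero]
  have hB : ∀ j, ∀ V ∈ L, (w j * V).trace / e ∈ k := by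
    intro j V hV
    induction hV using Submodule.span_induction with
    | mem V hV =>
      obtain ⟨l, rfl⟩ := hV
      simpa [w, mul_assoc, mul_left_comm] using hk j l
    | zero => simp
    | add U V _ _ hU hV =>
      rw [mul_add, Matrix.trace_add, add_div]
      exact add_mem hU hV
    | smul r V _ hV =>
      rw [mul_smul_comm, Matrix.trace_smul, Subfield.smul_def, smul_eq_mul, mul_div_assoc]
      exact mul_mem r.2 hV
  have hself : ∀ j, (w j * w j).trace = -2 * c j ^ 2 * (A j : Matrix (Fin 2) (Fin 2) F).det := by
    intro j
    simp only [w]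
    rw [smul_mul_smul_comm, ← sq, ← sq, sq_eq, trace_eq_zero (hA j)]
    simp
    ring
  have hstab : ∀ x ∈ Submonoid.closure (Set.range fun i => mk (A i)), ∀ u : GL (Fin 2) F,
      mk u = x → ∀ V ∈ L, (u : Matrix (Fin 2) (Fin 2) F) * V * (u⁻¹ : GL (Fin 2) F) ∈ L := by
    intro x hx
    induction hx using Submonoid.closure_induction with
    | mem x hx =>
      obtain ⟨j, rfl⟩ := hx
      intro u hu V hV
      rw [conj_eq_of_mk_eq hu, conj_eq_reflection (hA j) (htr V hV)]
      refine sub_mem (neg_mem hV) ?_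
      have hr : (w j * V).trace / e / ((w j * w j).trace / e) ∈ k :=
        div_mem (hB j V hV) (hB j _ (hwL j))
      convert L.smul_mem ⟨_, mul_mem (neg_mem hk2) hr⟩ (hwL j) using 1
      rw [Subfield.smul_def]
      simp only [hself]
      simp only [w, smul_smul, smul_mul_assoc, Matrix.trace_smul, smul_eq_mul]
      congr 1
      have := det_ne_zero (A j)
      have := hc j
      field_simp
    | one =>
      intro u hu V hV
      rw [conj_eq_of_mk_eq (w := 1) hu]
      simpa using hV
    | mul x y _ _ hx hy =>
      intro u hu V hV
      induction x using QuotientGroup.induction_on with | H x =>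
      induction y using QuotientGroup.induction_on with | H y =>
      rw [conj_eq_of_mk_eq (w := x * y) hu]
      simpa [mul_assoc] using hx x rfl _ (hy y rfl V hV)
  have hmem : mk g ∈ Submonoid.closure (Set.range fun i => mk (A i)) := by
    rw [← Subgroup.closure_toSubmonoid_of_finite, hgen]
    trivial
  have h1 := div_mem (hB i _ (hstab _ hmem g rfl _ (hwL i))) (hB i _ (hwL i))
  convert mul_mem (neg_mem hk2) h1 using 1
  rw [hself]
  simp only [w, mul_smul_comm, smul_mul_assoc, smul_smul, Matrix.trace_smul, smul_eq_mul]
  have := det_ne_zero (A i)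
  have := hc i
  field_simp

lemma eq_top_of_trace_conj_mem_of_ne_zero {u : GL (Fin 2) F} (h2 : (2 : F) ≠ 0)
    (hu : orderOf (mk u) = 2) (h10 : u 1 0 ≠ 0) {k : Subfield F}
    (hk : ∀ g : GL (Fin 2) F, ((u : Matrix (Fin 2) (Fin 2) F) *
      ((g : Matrix (Fin 2) (Fin 2) F) * (u : Matrix (Fin 2) (Fin 2) F) *
        (g⁻¹ : GL (Fin 2) F))).trace / (u : Matrix (Fin 2) (Fin 2) F).det ∈ k) : k = ⊤ := by
  have hk2 : (2 : F) ∈ k := ofNat_mem k 2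
  have hd := det_ne_zero u
  have h1 : ∀ t : F, -2 - t ^ 2 * u 1 0 ^ 2 / (u : Matrix (Fin 2) (Fin 2) F).det ∈ k := by
    intro t
    have ht := hk ⟨!![1, t; 0, 1], !![1, -t; 0, 1], by simp [Matrix.one_fin_two],
      by simp [Matrix.one_fin_two]⟩
    convert ht using 1
    rw [eq_div_iff hd, sub_mul, div_mul_cancel₀ _ hd, Matrix.det_fin_two, Matrix.trace_fin_two]
    simp [Matrix.mul_apply, Matrix.vecMul, dotProduct, Fin.sum_univ_two, apply_one_one hu]
    ring
  have h3 : ∀ t : F, t ^ 2 * u 1 0 ^ 2 / (u : Matrix (Fin 2) (Fin 2) F).det ∈ k := by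
    intro t
    convert sub_mem (neg_mem hk2) (h1 t) using 1
    ring
  have h4 : ∀ t : F, t ^ 2 ∈ k := by
    intro t
    convert div_mem (h3 t) (h3 1) using 1
    field_simp
  rw [eq_top_iff]
  intro t _
  convert div_mem (sub_mem (sub_mem (h4 (t + 1)) (h4 t)) (one_mem k)) hk2 using 1
  field_simp
  ring

lemma eq_top_of_trace_conj_mem {u : GL (Fin 2) F} (h2 : (2 : F) ≠ 0)
    (hu : orderOf (mk u) = 2) {k : Subfield F}
    (hk : ∀ g : GL (Fin 2) F, ((u : Matrix (Fin 2) (Fin 2) F) *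
      ((g : Matrix (Fin 2) (Fin 2) F) * (u : Matrix (Fin 2) (Fin 2) F) *
        (g⁻¹ : GL (Fin 2) F))).trace / (u : Matrix (Fin 2) (Fin 2) F).det ∈ k) : k = ⊤ := by
  obtain ⟨h, hh⟩ : ∃ h : GL (Fin 2) F, (h * u * h⁻¹) 1 0 ≠ 0 := by
    by_contra! H
    have e1 := H 1
    have e2 := H ⟨!![0, 1; 1, 0], !![0, 1; 1, 0], by simp [Matrix.one_fin_two],
      by simp [Matrix.one_fin_two]⟩
    have e3 := H ⟨!![1, 0; 1, 1], !![1, 0; -1, 1], by simp [Matrix.one_fin_two],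
      by simp [Matrix.one_fin_two]⟩
    simp only [Units.val_mul, Matrix.mul_apply, Fin.sum_univ_two, inv_one, Units.val_one,
      Units.inv_mk, Matrix.of_apply, Matrix.cons_val] at e1 e2 e3
    simp [apply_one_one hu] at e1 e2 e3
    apply ne_one_of_orderOf_eq_two hu
    rw [mk_eq_one_iff, apply_one_one hu]
    grind
  refine eq_top_of_trace_conj_mem_of_ne_zero h2 (u := h * u * h⁻¹) ?_ hh fun g => ?_
  · change orderOf (mk h * mk u * (mk h)⁻¹) = 2
    rw [orderOf_conj_eq, hu]
  · convert hk (h⁻¹ * g * h) using 2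
    · simp only [Units.val_mul, _root_.mul_inv_rev, inv_inv, mul_assoc]
      rw [Matrix.trace_mul_comm]
      simp only [mul_assoc]
    · simp only [Units.val_mul, Matrix.det_mul]
      rw [mul_right_comm, ← Matrix.det_mul, Units.mul_inv, Matrix.det_one, one_mul]

lemma card_le_of_eqLocusField_eq_top {F : Type*} [Field F] [Fintype F] {p m : ℕ} [Fact p.Prime]
    [CharP F p] (hm : 1 < p ^ m)
    (htop : (iterateFrobenius F p m).eqLocusField (RingHom.id F) = ⊤) :
    Fintype.card F ≤ p ^ m := by
  have hx : ∀ x : Fˣ, x ^ (p ^ m - 1) = 1 := by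
    intro x
    have hx : (x : F) ∈ (iterateFrobenius F p m).eqLocusField (RingHom.id F) := by
      rw [htop]; trivial
    rw [RingHom.mem_eqLocusField, iterateFrobenius_def, RingHom.id_apply] at hx
    rw [← mul_left_inj x, ← pow_succ, Nat.sub_add_cancel hm.le, one_mul]
    ext
    exact hx
  have := Nat.le_of_dvd (by omega) ((FiniteField.forall_pow_eq_one_iff F _).mp hx)
  omega

end ProjectiveGeneralLinearGroup

namespace ProjectiveGeneralLinearGroup

open Matrix
open scoped LinearAlgebra.Projectivization

variable {F : Type*} [Field F]

/-- The vanishing of the Gram determinant of four traceless matrices whose pairwise trace forms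
vanish except for consecutive ones. -/
lemma gram_relation {A B C D : GL (Fin 2) F} (hA : orderOf (mk A) = 2)
    (hB : orderOf (mk B) = 2) (hC : orderOf (mk C) = 2) (hD : orderOf (mk D) = 2)
    (hAC : ((A : Matrix (Fin 2) (Fin 2) F) * (C : Matrix (Fin 2) (Fin 2) F)).trace = 0)
    (hAD : ((A : Matrix (Fin 2) (Fin 2) F) * (D : Matrix (Fin 2) (Fin 2) F)).trace = 0)
    (hBD : ((B : Matrix (Fin 2) (Fin 2) F) * (D : Matrix (Fin 2) (Fin 2) F)).trace = 0)
    {a b c d s t r : F} (ha : (A : Matrix (Fin 2) (Fin 2) F).det = a)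
    (hb : (B : Matrix (Fin 2) (Fin 2) F).det = b)
    (hc : (C : Matrix (Fin 2) (Fin 2) F).det = c) (hd : (D : Matrix (Fin 2) (Fin 2) F).det = d)
    (hs : ((A : Matrix (Fin 2) (Fin 2) F) * (B : Matrix (Fin 2) (Fin 2) F)).trace = s)
    (ht : ((B : Matrix (Fin 2) (Fin 2) F) * (C : Matrix (Fin 2) (Fin 2) F)).trace = t)
    (hr : ((C : Matrix (Fin 2) (Fin 2) F) * (D : Matrix (Fin 2) (Fin 2) F)).trace = r) :
    (4 * a * b - s ^ 2) * (4 * c * d - r ^ 2) = 4 * a * d * t ^ 2 := by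
  rw [trace_mul_eq hA hC] at hAC
  rw [trace_mul_eq hA hD] at hAD
  rw [trace_mul_eq hB hD] at hBD
  rw [trace_mul_eq hA hB] at hs
  rw [trace_mul_eq hB hC] at ht
  rw [trace_mul_eq hC hD] at hr
  rw [Matrix.det_fin_two, apply_one_one hA] at ha
  rw [Matrix.det_fin_two, apply_one_one hB] at hb
  rw [Matrix.det_fin_two, apply_one_one hC] at hc
  rw [Matrix.det_fin_two, apply_one_one hD] at hd
  let V : Matrix (Fin 4) (Fin 4) F := !![A 0 0, A 0 1, A 1 0, 0; B 0 0, B 0 1, B 1 0, 0;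
    C 0 0, C 0 1, C 1 0, 0; D 0 0, D 0 1, D 1 0, 0]
  let W : Matrix (Fin 4) (Fin 4) F := !![2 * A 0 0, 2 * B 0 0, 2 * C 0 0, 2 * D 0 0;
    A 1 0, B 1 0, C 1 0, D 1 0; A 0 1, B 0 1, C 0 1, D 0 1; 0, 0, 0, 0]
  have hVW : V * W = !![-2 * a, s, 0, 0; s, -2 * b, t, 0; 0, t, -2 * c, r; 0, 0, r, -2 * d] := by
    ext i j
    fin_cases i <;> fin_cases j <;> simp [V, W, Matrix.mul_apply, Fin.sum_univ_four] <;>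
      grind
  have hdet : (V * W).det = 0 := by
    rw [Matrix.det_mul, Matrix.det_eq_zero_of_column_eq_zero (A := V) 3
      (by intro i; fin_cases i <;> simp [V]), zero_mul]
  rw [hVW] at hdet
  simp [Matrix.det_succ_row_zero, Fin.sum_univ_succ, Fin.succAbove] at hdet
  linear_combination hdet

/-- In odd characteristic, fixed-point multipliers of order dividing `q - 1` or `q + 1` give
trace invariants in the subfield with `q` elements. -/
lemma trace_sq_div_det_pow {K : Type*} [Field K] [Algebra F K] {p : ℕ} [Fact p.Prime] [CharP F p]
    {m : ℕ} (hm : 1 < p ^ m) {u : GL (Fin 2) F} {x : ℙ K (Fin 2 → K)} (hx : mk u • x = x)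
    (h : multiplier (mk u) x ^ (p ^ m - 1) = 1 ∨ multiplier (mk u) x ^ (p ^ m + 1) = 1) :
    ((u : Matrix (Fin 2) (Fin 2) F).trace ^ 2 / (u : Matrix (Fin 2) (Fin 2) F).det) ^ p ^ m =
      (u : Matrix (Fin 2) (Fin 2) F).trace ^ 2 / (u : Matrix (Fin 2) (Fin 2) F).det := by
  have hK : CharP K p := charP_of_injective_algebraMap (algebraMap F K).injective p
  apply (algebraMap F K).injective
  rw [map_pow, trace_sq_div_det hx, ← iterateFrobenius_def]
  simp only [map_add, map_inv₀, map_ofNat]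
  rw [iterateFrobenius_def]
  set χ := multiplier (mk u) x
  rcases h with h | h
  · have : χ ^ p ^ m = χ := by
      rw [← Nat.sub_add_cancel hm.le, pow_succ, h, one_mul]
    rw [this]
  · have : χ ^ p ^ m = χ⁻¹ := eq_inv_of_mul_eq_one_left (by rw [← pow_succ, h])
    rw [this, inv_inv]
    ring

end ProjectiveGeneralLinearGroup

namespace IsStringQuadruple

open Matrix ProjectiveGeneralLinearGroup
open scoped LinearAlgebra.Projectivization

variable {F : Type*} [Field F] {A B C D : GL (Fin 2) F}

lemma trace_ab_ne_zero [Finite F] (h : IsStringQuadruple (mk A) (mk B) (mk C) (mk D))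
    (h2 : (2 : F) ≠ 0) :
    ((A : Matrix (Fin 2) (Fin 2) F) * (B : Matrix (Fin 2) (Fin 2) F)).trace ≠ 0 := fun h0 =>
  h.not_commute_ab (isCrossUnique h2) (commute_of_trace_eq_zero h.orderOf_a h.orderOf_b h0)

lemma trace_bc_ne_zero (h : IsStringQuadruple (mk A) (mk B) (mk C) (mk D)) (h2 : (2 : F) ≠ 0) :
    ((B : Matrix (Fin 2) (Fin 2) F) * (C : Matrix (Fin 2) (Fin 2) F)).trace ≠ 0 := fun h0 =>
  h.not_commute_bc (isCrossUnique h2) (commute_of_trace_eq_zero h.orderOf_b h.orderOf_c h0)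

lemma trace_cd_ne_zero [Finite F] (h : IsStringQuadruple (mk A) (mk B) (mk C) (mk D))
    (h2 : (2 : F) ≠ 0) :
    ((C : Matrix (Fin 2) (Fin 2) F) * (D : Matrix (Fin 2) (Fin 2) F)).trace ≠ 0 := by
  rw [Matrix.trace_mul_comm]
  exact h.symm.trace_ab_ne_zero h2

lemma trace_ac (h : IsStringQuadruple (mk A) (mk B) (mk C) (mk D)) :
    ((A : Matrix (Fin 2) (Fin 2) F) * (C : Matrix (Fin 2) (Fin 2) F)).trace = 0 :=
  trace_eq_zero_of_commute h.orderOf_a h.orderOf_c h.ne_ac h.comm_ac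

lemma trace_ad (h : IsStringQuadruple (mk A) (mk B) (mk C) (mk D)) :
    ((A : Matrix (Fin 2) (Fin 2) F) * (D : Matrix (Fin 2) (Fin 2) F)).trace = 0 :=
  trace_eq_zero_of_commute h.orderOf_a h.orderOf_d h.ne_ad h.comm_ad

lemma trace_bd (h : IsStringQuadruple (mk A) (mk B) (mk C) (mk D)) :
    ((B : Matrix (Fin 2) (Fin 2) F) * (D : Matrix (Fin 2) (Fin 2) F)).trace = 0 :=
  trace_eq_zero_of_commute h.orderOf_b h.orderOf_d h.symm.ne_ac.symm h.comm_bd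

lemma four_sub_mul_four_sub (h : IsStringQuadruple (mk A) (mk B) (mk C) (mk D)) :
    (4 - ((A * B : GL (Fin 2) F) : Matrix (Fin 2) (Fin 2) F).trace ^ 2 /
        ((A * B : GL (Fin 2) F) : Matrix (Fin 2) (Fin 2) F).det) *
      (4 - ((C * D : GL (Fin 2) F) : Matrix (Fin 2) (Fin 2) F).trace ^ 2 /
        ((C * D : GL (Fin 2) F) : Matrix (Fin 2) (Fin 2) F).det) =
      4 * (((B * C : GL (Fin 2) F) : Matrix (Fin 2) (Fin 2) F).trace ^ 2 /
        ((B * C : GL (Fin 2) F) : Matrix (Fin 2) (Fin 2) F).det) := by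
  simp only [Units.val_mul, Matrix.det_mul]
  have := det_ne_zero A
  have := det_ne_zero B
  have := det_ne_zero C
  have := det_ne_zero D
  field_simp
  linear_combination gram_relation h.orderOf_a h.orderOf_b h.orderOf_c h.orderOf_d h.trace_ac
    h.trace_ad h.trace_bd rfl rfl rfl rfl rfl rfl rfl

lemma subfield_eq_top [Finite F] (h : IsStringQuadruple (mk A) (mk B) (mk C) (mk D))
    (h2 : (2 : F) ≠ 0) {k : Subfield F}
    (hx : ((A * B : GL (Fin 2) F) : Matrix (Fin 2) (Fin 2) F).trace ^ 2 /
      ((A * B : GL (Fin 2) F) : Matrix (Fin 2) (Fin 2) F).det ∈ k)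
    (hy : ((B * C : GL (Fin 2) F) : Matrix (Fin 2) (Fin 2) F).trace ^ 2 /
      ((B * C : GL (Fin 2) F) : Matrix (Fin 2) (Fin 2) F).det ∈ k)
    (hz : ((C * D : GL (Fin 2) F) : Matrix (Fin 2) (Fin 2) F).trace ^ 2 /
      ((C * D : GL (Fin 2) F) : Matrix (Fin 2) (Fin 2) F).det ∈ k) : k = ⊤ := by
  have hk2 : (-2 : F) ∈ k := neg_mem (ofNat_mem k 2)
  have hs := h.trace_ab_ne_zero h2
  have ht := h.trace_bc_ne_zero h2
  have hr := h.trace_cd_ne_zero h2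
  have hac := h.trace_ac
  have had := h.trace_ad
  have hbd := h.trace_bd
  have hca := hac
  have hda := had
  have hdb := hbd
  have hba := Matrix.trace_mul_comm (B : Matrix (Fin 2) (Fin 2) F) (A : Matrix (Fin 2) (Fin 2) F)
  have hcb := Matrix.trace_mul_comm (C : Matrix (Fin 2) (Fin 2) F) (B : Matrix (Fin 2) (Fin 2) F)
  have hdc := Matrix.trace_mul_comm (D : Matrix (Fin 2) (Fin 2) F) (C : Matrix (Fin 2) (Fin 2) F)
  rw [Matrix.trace_mul_comm] at hca hda hdb
  have hself : ∀ {u : GL (Fin 2) F}, orderOf (mk u) = 2 →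
      ((u : Matrix (Fin 2) (Fin 2) F) * (u : Matrix (Fin 2) (Fin 2) F)).trace =
        -2 * (u : Matrix (Fin 2) (Fin 2) F).det := by
    intro u hu
    rw [← sq, sq_eq, trace_eq_zero hu]
    simp [mul_comm]
  have haa := hself h.orderOf_a
  have hbb := hself h.orderOf_b
  have hcc := hself h.orderOf_c
  have hdd := hself h.orderOf_d
  have h1 := det_ne_zero A
  have h3 := det_ne_zero B
  have h4 := det_ne_zero C
  have h5 := det_ne_zero D
  simp only [Units.val_mul, Matrix.det_mul] at hx hy hz
  have hxy := mul_mem hx hy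
  have hxyz := mul_mem hxy hz
  set s := ((A : Matrix (Fin 2) (Fin 2) F) * (B : Matrix (Fin 2) (Fin 2) F)).trace
  set t := ((B : Matrix (Fin 2) (Fin 2) F) * (C : Matrix (Fin 2) (Fin 2) F)).trace
  set r := ((C : Matrix (Fin 2) (Fin 2) F) * (D : Matrix (Fin 2) (Fin 2) F)).trace
  set a := (A : Matrix (Fin 2) (Fin 2) F).det
  set b := (B : Matrix (Fin 2) (Fin 2) F).det
  set c := (C : Matrix (Fin 2) (Fin 2) F).det
  set d := (D : Matrix (Fin 2) (Fin 2) F).det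
  refine eq_top_of_trace_conj_mem h2 h.orderOf_a (trace_conj_mem h2 (A := ![A, B, C, D])
    (c := ![1, s / b, s * t / (b * c), s * t * r / (b * c * d)]) (e := a) ?_ ?_ ?_ h1 ?_ 0)
  · intro i
    fin_cases i
    exacts [h.orderOf_a, h.orderOf_b, h.orderOf_c, h.orderOf_d]
  · rw [← h.closure_eq_top]
    congr 1
    ext x
    simp [Fin.exists_fin_succ, eq_comm]
  · intro i
    fin_cases i <;> simp <;> grind
  · intro i j
    fin_cases i <;> fin_cases j <;>
      simp only [Fin.zero_eta, Fin.mk_one, Fin.reduceFinMk, Matrix.cons_val]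
    · convert hk2 using 1
      rw [haa]; field_simp
    · convert hx using 1
      field_simp
      rfl
    · simp [hac]
    · simp [had]
    · convert hx using 1
      rw [hba]; field_simp
    · convert mul_mem hk2 hx using 1
      rw [hbb]; field_simp
    · convert hxy using 1
      field_simp
      rfl
    · simp [hbd]
    · simp [hca]
    · convert hxy using 1
      rw [hcb]; field_simp
    · convert mul_mem hk2 hxy using 1
      rw [hcc]; field_simp
    · convert hxyz using 1
      field_simp
      rfl
    · simp [hda]
    · simp [hdb]
    · convert hxyz using 1
      rw [hdc]; field_simp
    · convert mul_mem hk2 hxyz using 1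
      rw [hdd]; field_simp

lemma orderOf_le_four {F : Type*} [Field F] [Fintype F] (h2 : (2 : F) ≠ 0)
    {a b c d : ProjectiveGeneralLinearGroup (Fin 2) F} (h : IsStringQuadruple a b c d)
    {g : ProjectiveGeneralLinearGroup (Fin 2) F} (hg : g ∈ Subgroup.closure {a, b, c}) :
    orderOf g ≤ 4 := by
  obtain ⟨p, hp⟩ := CharP.exists F
  have : Fact p.Prime := ⟨CharP.char_is_prime F p⟩
  have hp2 : p ≠ 2 := by
    rintro rfl
    exact h2 (CharP.cast_eq_zero F 2)
  obtain ⟨K, _, _, hK, hroot⟩ := exists_finite_extension F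
  have hKp : CharP K p := charP_of_injective_algebraMap (algebraMap F K).injective p
  obtain ⟨δ, hδ⟩ := exists_hom_ne_one F h2
  have hχ := isMultiplier p hroot
  rcases h.orderOf_le_four_or (isCrossUnique h2) hχ hp2 hδ with h1 | ⟨m, hm, hcard, h1⟩
  · exact h1 g hg
  exfalso
  obtain ⟨A, rfl⟩ := QuotientGroup.mk_surjective a
  obtain ⟨B, rfl⟩ := QuotientGroup.mk_surjective b
  obtain ⟨C, rfl⟩ := QuotientGroup.mk_surjective c
  obtain ⟨D, rfl⟩ := QuotientGroup.mk_surjective d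
  have hmem : ∀ u : GL (Fin 2) F, mk u ∈ Subgroup.closure {mk A, mk B, mk C} →
      (u : Matrix (Fin 2) (Fin 2) F).trace ^ 2 / (u : Matrix (Fin 2) (Fin 2) F).det ∈
        (iterateFrobenius F p m).eqLocusField (RingHom.id F) := by
    intro u hu
    obtain ⟨x, hx⟩ := hχ.exists_fixed (mk u)
    exact trace_sq_div_det_pow hm hx (h1 _ hu x hx)
  have hx := hmem (A * B) (show mk A * mk B ∈ _ from mul_mem (Subgroup.subset_closure (by simp))
    (Subgroup.subset_closure (by simp)))
  have hy := hmem (B * C) (show mk B * mk C ∈ _ from mul_mem (Subgroup.subset_closure (by simp))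
    (Subgroup.subset_closure (by simp)))
  have hrel := h.four_sub_mul_four_sub
  have hy0 : ((B * C : GL (Fin 2) F) : Matrix (Fin 2) (Fin 2) F).trace ^ 2 /
      ((B * C : GL (Fin 2) F) : Matrix (Fin 2) (Fin 2) F).det ≠ 0 :=
    div_ne_zero (pow_ne_zero 2 (h.trace_bc_ne_zero h2)) (det_ne_zero _)
  have h4 : (4 : F) ≠ 0 := by
    rw [show (4 : F) = 2 * 2 by norm_num]
    exact mul_ne_zero h2 h2
  have hz := h.subfield_eq_top h2 hx hy (by
    set k := (iterateFrobenius F p m).eqLocusField (RingHom.id F)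
    have hx4 := left_ne_zero_of_mul (hrel ▸ mul_ne_zero h4 hy0)
    have hk4 : (4 : F) ∈ k := ofNat_mem k 4
    convert sub_mem hk4 (div_mem (mul_mem hk4 hy) (sub_mem hk4 hx)) using 1
    rw [← hrel, mul_div_cancel_left₀ _ hx4]
    ring)
  have hq := card_le_of_eqLocusField_eq_top hm hz
  have hlt := h.two_mul_card_lt (isCrossUnique h2)
  have hle := card_le F
  have : Fintype.card F * ((Fintype.card F - 1) * (Fintype.card F + 1)) ≤
      p ^ m * ((p ^ m - 1) * (p ^ m + 1)) := by gcongr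
  omega

theorem card_eq_five {F : Type*} [Field F] [Fintype F] (h2 : (2 : F) ≠ 0)
    {a b c d : ProjectiveGeneralLinearGroup (Fin 2) F} (h : IsStringQuadruple a b c d) :
    Fintype.card F = 5 := by
  have hG := isCrossUnique h2
  have hthree : ∀ {a b c d : ProjectiveGeneralLinearGroup (Fin 2) F}, IsStringQuadruple a b c d →
      orderOf (a * b) = 3 := by
    intro a b c d h
    have h1 := h.orderOf_le_four h2 (mul_mem (Subgroup.subset_closure (by simp))
      (Subgroup.subset_closure (by simp)) : a * b ∈ Subgroup.closure {a, b, c})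
    have h3 := h.odd_orderOf_mul hG
    have h5 : orderOf (a * b) ≠ 1 := fun h5 => h.ne_ab (by
      rw [orderOf_eq_one_iff, mul_eq_one_iff_eq_inv, inv_of_orderOf_eq_two h.orderOf_b] at h5
      exact h5)
    grind
  have hab := hthree h
  have hdc := hthree h.symm
  have hbc := h.orderOf_le_four h2 (mul_mem (Subgroup.subset_closure (by simp))
      (Subgroup.subset_closure (by simp)) : b * c ∈ Subgroup.closure {a, b, c})
  have hbc0 := orderOf_pos (b * c)
  have hbc1 : orderOf (b * c) ≠ 1 := fun h5 => h.ne_bc (by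
    rw [orderOf_eq_one_iff, mul_eq_one_iff_eq_inv, inv_of_orderOf_eq_two h.orderOf_c] at h5
    exact h5)
  have hbc2 : orderOf (b * c) ≠ 2 := fun h5 => h.not_commute_bc hG (by
    have := inv_of_orderOf_eq_two h5
    rw [_root_.mul_inv_rev, inv_of_orderOf_eq_two h.orderOf_b, inv_of_orderOf_eq_two h.orderOf_c] at this
    exact this.symm)
  obtain ⟨A, rfl⟩ := QuotientGroup.mk_surjective a
  obtain ⟨B, rfl⟩ := QuotientGroup.mk_surjective b
  obtain ⟨C, rfl⟩ := QuotientGroup.mk_surjective c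
  obtain ⟨D, rfl⟩ := QuotientGroup.mk_surjective d
  have hx : ((A * B : GL (Fin 2) F) : Matrix (Fin 2) (Fin 2) F).trace ^ 2 /
      ((A * B : GL (Fin 2) F) : Matrix (Fin 2) (Fin 2) F).det = 1 := by
    rw [div_eq_one_iff_eq (det_ne_zero _)]
    exact trace_sq_of_orderOf_eq_three hab
  have hz : ((C * D : GL (Fin 2) F) : Matrix (Fin 2) (Fin 2) F).trace ^ 2 /
      ((C * D : GL (Fin 2) F) : Matrix (Fin 2) (Fin 2) F).det = 1 := by
    rw [div_eq_one_iff_eq (det_ne_zero _), Units.val_mul, Matrix.trace_mul_comm,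
      Matrix.det_mul_comm, ← Units.val_mul]
    exact trace_sq_of_orderOf_eq_three hdc
  have hrel := h.four_sub_mul_four_sub
  rw [hx, hz] at hrel
  obtain h3 | h4 : orderOf (mk (B * C)) = 3 ∨ orderOf (mk (B * C)) = 4 := by
    have h3 : ∀ n ≤ 4, 0 < n → n ≠ 1 → n ≠ 2 → n = 3 ∨ n = 4 := by omega
    exact h3 _ hbc hbc0 hbc1 hbc2
  · have hy : ((B * C : GL (Fin 2) F) : Matrix (Fin 2) (Fin 2) F).trace ^ 2 /
        ((B * C : GL (Fin 2) F) : Matrix (Fin 2) (Fin 2) F).det = 1 := by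
      rw [div_eq_one_iff_eq (det_ne_zero _)]
      exact trace_sq_of_orderOf_eq_three h3
    rw [hy] at hrel
    have h5 : ((5 : ℕ) : F) = 0 := by
      push_cast
      linear_combination hrel
    have : Fact (Nat.Prime 5) := ⟨by norm_num⟩
    have : CharP F 5 := (CharP.charP_iff_prime_eq_zero (by norm_num)).mpr h5
    have htop := h.subfield_eq_top h2
      (k := (iterateFrobenius F 5 1).eqLocusField (RingHom.id F))
      (by rw [hx]; exact one_mem _) (by rw [hy]; exact one_mem _) (by rw [hz]; exact one_mem _)
    have hle := card_le_of_eqLocusField_eq_top (by norm_num) htop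
    have hdvd := (CharP.cast_eq_zero_iff F 5 _).mp (Nat.cast_card_eq_zero F)
    have := Nat.le_of_dvd Fintype.card_pos hdvd
    omega
  · exfalso
    rw [trace_sq_of_orderOf_eq_four h4, mul_div_cancel_right₀ _ (det_ne_zero _)] at hrel
    apply one_ne_zero (α := F)
    linear_combination hrel

end IsStringQuadruple

namespace IsStringCGroupRep

open ProjectiveGeneralLinearGroup

section Group

variable {G : Type*} [Group G] {n : ℕ} {ρ : Fin n → G}

lemma notMem_closure (h : IsStringCGroupRep ρ) {i : Fin n} {I : Set (Fin n)} (hi : i ∉ I) :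
    ρ i ∉ Subgroup.closure (ρ '' I) := by
  intro hmem
  have h1 : ρ i ∈ Subgroup.closure (ρ '' I) ⊓ Subgroup.closure (ρ '' {i}) :=
    ⟨hmem, Subgroup.subset_closure (by simp)⟩
  rw [h.2.2.2, Set.inter_singleton_eq_empty.mpr hi, Set.image_empty, Subgroup.closure_empty] at h1
  exact ne_one_of_orderOf_eq_two (h.1 i) h1

lemma injective (h : IsStringCGroupRep ρ) : Function.Injective ρ := by
  intro i j hij
  by_contra hne
  exact h.notMem_closure (I := {j}) hne (hij ▸ Subgroup.subset_closure (by simp))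

lemma isStringQuadruple {ρ : Fin 4 → G} (h : IsStringCGroupRep ρ) :
    IsStringQuadruple (ρ 0) (ρ 1) (ρ 2) (ρ 3) where
  orderOf_a := h.1 0
  orderOf_b := h.1 1
  orderOf_c := h.1 2
  orderOf_d := h.1 3
  comm_ac := h.2.2.1 0 2 (by decide)
  comm_ad := h.2.2.1 0 3 (by decide)
  comm_bd := h.2.2.1 1 3 (by decide)
  a_notMem := by simpa [Set.image_insert_eq] using h.notMem_closure (i := 0) (I := {1, 2, 3})
  b_notMem := by simpa [Set.image_insert_eq] using h.notMem_closure (i := 1) (I := {0, 2, 3})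
  c_notMem := by simpa [Set.image_insert_eq] using h.notMem_closure (i := 2) (I := {0, 1, 3})
  d_notMem := by simpa [Set.image_insert_eq] using h.notMem_closure (i := 3) (I := {0, 1, 2})
  closure_eq_top := by
    rw [← h.2.1]
    congr 1
    ext x
    simp [Fin.exists_fin_succ, eq_comm]

lemma le_four_of_isCrossUnique (hG : IsCrossUnique G) (h : IsStringCGroupRep ρ) : n ≤ 4 := by
  by_contra! hn
  set i : Fin n := ⟨0, by omega⟩ with hi
  set j : Fin n := ⟨2, by omega⟩ with hj
  set k : Fin n := ⟨4, by omega⟩ with hk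
  have hij : i ≠ j := by simp [hi, hj]
  have hik : i ≠ k := by simp [hi, hk]
  have hjk : j ≠ k := by simp [hj, hk]
  have cij : Commute (ρ i) (ρ j) := h.2.2.1 i j (by simp [hi, hj])
  have cik : Commute (ρ i) (ρ k) := h.2.2.1 i k (by simp [hi, hk])
  have cjk : Commute (ρ j) (ρ k) := h.2.2.1 j k (by simp [hj, hk])
  have hne := h.injective.ne hij
  refine h.notMem_closure (i := k) (I := {i, j}) (by simp [hik.symm, hjk.symm]) ?_
  have huv : ρ i * ρ j = ρ k := hG (h.1 i) (h.1 j)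
    (orderOf_mul_eq_two (h.1 i) (h.1 j) hne cij) (h.1 k) hne
    (by simpa using ne_one_of_orderOf_eq_two (h.1 j))
    (by simpa using ne_one_of_orderOf_eq_two (h.1 i))
    (h.injective.ne hik.symm) (h.injective.ne hjk.symm)
    ((Commute.refl _).mul_left cij.symm) (cij.mul_left (Commute.refl _)) cik.symm cjk.symm
  rw [← huv]
  exact mul_mem (Subgroup.subset_closure (by simp)) (Subgroup.subset_closure (by simp))

end Group

variable {F : Type*} [Field F] {n : ℕ} {ρ : Fin n → ProjectiveGeneralLinearGroup (Fin 2) F}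

lemma lt_four_of_char_two (h2 : (2 : F) = 0) (h : IsStringCGroupRep ρ) : n < 4 := by
  by_contra! hn
  have key : ∀ i, Commute (ρ ⟨0, by omega⟩) (ρ i) := by
    intro i
    obtain h0 | h1 | h2' : i.val = 0 ∨ i.val = 1 ∨ 1 < i.val := by omega
    · rw [show i = ⟨0, by omega⟩ from Fin.ext h0]
    · exact commute_trans_of_char_two h2 (h.1 _) (h.1 ⟨3, by omega⟩) (h.1 _)
        (h.2.2.1 _ _ (by simp)) (h.2.2.1 _ _ (by simp [h1])).symm
    · exact h.2.2.1 _ _ (by simpa using h2')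
  have hcomm : ∀ x ∈ Set.range ρ, ∀ y ∈ Set.range ρ, x * y = y * x := by
    rintro _ ⟨i, rfl⟩ _ ⟨j, rfl⟩
    exact commute_trans_of_char_two h2 (h.1 _) (h.1 _) (h.1 _) (key i).symm (key j)
  obtain ⟨g, k, hgk⟩ := exists_not_commute (F := F)
  have htop : ∀ g, g ∈ Subgroup.closure (Set.range ρ) := by simp [h.2.1]
  exact hgk (congrArg Subtype.val
    ((Subgroup.isMulCommutative_closure hcomm).is_comm.comm ⟨g, htop g⟩ ⟨k, htop k⟩))

end IsStringCGroupRep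

section Perm

open Equiv

variable {n : ℕ}

lemma Fin.swap_castSucc_succ_le_iff {i j : Fin n} (h : i ≠ j) (k : Fin (n + 1)) :
    swap i.castSucc i.succ k ≤ j.castSucc ↔ k ≤ j.castSucc := by
  have h' : i.val ≠ j.val := fun h0 => h (Fin.ext h0)
  rw [swap_apply_def]
  split_ifs with h1 h2
  · subst h1
    simp only [Fin.le_def, Fin.val_succ, Fin.val_castSucc]
    omega
  · subst h2
    simp only [Fin.le_def, Fin.val_succ, Fin.val_castSucc]
    omega
  · rfl

lemma Equiv.Perm.sum_mul_swap_lt (σ : Perm (Fin (n + 1))) {j : Fin n}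
    (h : σ⁻¹ j.succ < σ⁻¹ j.castSucc) :
    ∑ k, k.val * (n - ((swap j.castSucc j.succ * σ)⁻¹ k).val) <
      ∑ k, k.val * (n - (σ⁻¹ k).val) := by
  have hne : j.castSucc ≠ j.succ := j.castSucc_lt_succ.ne
  have h1 : ∑ k, k.val * (n - ((swap j.castSucc j.succ * σ)⁻¹ k).val) =
      ∑ k, (swap j.castSucc j.succ k).val * (n - (σ⁻¹ k).val) := by
    rw [← Equiv.sum_comp (swap j.castSucc j.succ)]
    simp [mul_inv_rev]
  rw [h1]
  zify
  rw [← sub_pos, ← Finset.sum_sub_distrib,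
    Fintype.sum_eq_add j.castSucc j.succ hne (fun k hk => by rw [swap_apply_of_ne_of_ne hk.1 hk.2, sub_self]),
    swap_apply_left, swap_apply_right]
  have h2 := (σ⁻¹ j.castSucc).is_le
  have h3 : (σ⁻¹ j.succ).val < (σ⁻¹ j.castSucc).val := h
  rw [Nat.cast_sub h2, Nat.cast_sub (by omega)]
  push_cast [Fin.val_succ, Fin.val_castSucc]
  zify at h3
  linarith

lemma Equiv.Perm.mem_closure_swap (σ : Perm (Fin (n + 1))) (I : Set (Fin n))
    (h : ∀ j ∉ I, ∀ k, σ k ≤ j.castSucc ↔ k ≤ j.castSucc) :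
    σ ∈ Subgroup.closure ((fun i : Fin n => swap i.castSucc i.succ) '' I) := by
  induction hm : ∑ k, k.val * (n - (σ⁻¹ k).val) using Nat.strong_induction_on generalizing σ with
  | _ m ih =>
  subst hm
  by_cases hmono : StrictMono (σ⁻¹ : Perm (Fin (n + 1)))
  · have h1 : σ⁻¹ = 1 := by
      ext1 k
      exact congrFun ((hmono.range_inj strictMono_id).mp (by simp)) k
    rw [inv_eq_one.mp h1]
    exact one_mem _
  · rw [Fin.strictMono_iff_lt_succ] at hmono
    push Not at hmono
    obtain ⟨j, hj⟩ := hmono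
    have hj' : σ⁻¹ j.succ < σ⁻¹ j.castSucc :=
      lt_of_le_of_ne hj (σ⁻¹.injective.ne j.castSucc_lt_succ.ne')
    have hjI : j ∈ I := by
      by_contra hjI
      have h1 := (h j hjI (σ⁻¹ j.castSucc)).mp (by simp)
      have h2 := (h j hjI (σ⁻¹ j.succ)).mpr (hj.trans h1)
      simp at h2
    have hs : swap j.castSucc j.succ ∈
        Subgroup.closure ((fun i : Fin n => swap i.castSucc i.succ) '' I) :=
      Subgroup.subset_closure ⟨j, hjI, rfl⟩
    rw [← Subgroup.mul_mem_cancel_left _ hs]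
    refine ih _ (σ.sum_mul_swap_lt hj') _ (fun i hi k => ?_) rfl
    rw [Perm.mul_apply, Fin.swap_castSucc_succ_le_iff (by rintro rfl; exact hi hjI), h i hi]

lemma Equiv.Perm.mem_closure_swap_iff (σ : Perm (Fin (n + 1))) (I : Set (Fin n)) :
    σ ∈ Subgroup.closure ((fun i : Fin n => swap i.castSucc i.succ) '' I) ↔
      ∀ j ∉ I, ∀ k, σ k ≤ j.castSucc ↔ k ≤ j.castSucc := by
  refine ⟨fun hσ j hj => ?_, σ.mem_closure_swap I⟩
  induction hσ using Subgroup.closure_induction with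
  | mem x hx =>
    obtain ⟨i, hi, rfl⟩ := hx
    exact Fin.swap_castSucc_succ_le_iff (by rintro rfl; exact hj hi)
  | one => simp
  | mul x y _ _ hx hy => simp [hx, hy]
  | inv x _ hx => intro k; rw [← hx]; simp

/-- The adjacent transpositions are a string C-group representation of the symmetric group. -/
theorem isStringCGroupRep_swap (n : ℕ) :
    IsStringCGroupRep fun i : Fin n => swap i.castSucc i.succ := by
  refine ⟨fun i => (Perm.swap_isSwap_iff.mpr i.castSucc_lt_succ.ne).orderOf, ?_, fun i j hij => ?_,
    fun I J => ?_⟩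
  · rw [eq_top_iff, ← Set.image_univ]
    exact fun σ _ => (σ.mem_closure_swap_iff _).mpr (by simp)
  · refine (Perm.disjoint_swap_swap ?_).commute
    simp only [List.nodup_cons, List.mem_cons, List.not_mem_nil, Fin.ext_iff, Fin.val_succ,
      Fin.val_castSucc]
    simp
    omega
  · ext σ
    simp only [Subgroup.mem_inf, Perm.mem_closure_swap_iff, Set.mem_inter_iff, not_and_or]
    exact ⟨fun h j hj => hj.elim (h.1 j) (h.2 j), fun h => ⟨fun j hj => h j (.inl hj),
      fun j hj => h j (.inr hj)⟩⟩

lemma IsStringCGroupRep.of_injective {G H : Type*} [Group G] [Group H] {ρ : Fin n → G}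
    (φ : G →* H) (hφ : Function.Injective φ) (h : IsStringCGroupRep (φ ∘ ρ)) :
    IsStringCGroupRep ρ := by
  obtain ⟨h1, h2, h3, h4⟩ := h
  refine ⟨fun i => ?_, ?_, fun i j hij => ?_, fun I J => ?_⟩
  · rw [← orderOf_injective φ hφ]
    exact h1 i
  · apply Subgroup.map_injective hφ
    rw [MonoidHom.map_closure, ← Set.range_comp, h2, eq_comm, eq_top_iff, ← h2,
      Set.range_comp, ← MonoidHom.map_closure]
    exact Subgroup.map_mono le_top
  · exact hφ (by simpa using (h3 i j hij).eq)
  · apply Subgroup.map_injective hφ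
    rw [Subgroup.map_inf _ _ _ hφ]
    simpa only [MonoidHom.map_closure, ← Set.image_comp] using h4 I J

end Perm

section FiveFrames

open Matrix

/-- The traceless matrix fixing the points `t` and `∞` of the projective line over `ZMod 5`. -/
def frameMatrix (t : ZMod 5) : Matrix (Fin 2) (Fin 2) (ZMod 5) := !![1, 3 * t; 0, -1]

/-- For a traceless matrix whose determinant is a nonzero square, the index `t` such that it is a
multiple of `frameMatrix t` or commutes with it up to sign. -/
def frameIndex (M : Matrix (Fin 2) (Fin 2) (ZMod 5)) : ZMod 5 :=
  M 0 0 * M 1 0 ^ 3 + 2 * M 0 1 * M 0 0 ^ 3 * (1 - M 1 0 ^ 4)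

lemma pow_four_eq_one {k : ZMod 5} (hk : k ≠ 0) : k ^ 4 = 1 := by
  revert k
  decide

lemma det_ne_zero_zmod_five (u : GL (Fin 2) (ZMod 5)) : u.val.det ≠ 0 := by
  have : Nontrivial (ZMod 5) := ⟨0, 1, by decide⟩
  exact ((Matrix.isUnit_iff_isUnit_det _).mp u.isUnit).ne_zero

lemma frameIndex_smul {k : ZMod 5} (hk : k ≠ 0) (M : Matrix (Fin 2) (Fin 2) (ZMod 5)) :
    frameIndex (k • M) = frameIndex M := by
  have hk4 := pow_four_eq_one hk
  simp only [frameIndex, Matrix.smul_apply, smul_eq_mul]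
  linear_combination (M 0 0 * M 1 0 ^ 3 + 2 * M 0 1 * M 0 0 ^ 3 * (1 - M 1 0 ^ 4) -
    2 * M 0 1 * M 0 0 ^ 3 * M 1 0 ^ 4 * k ^ 4) * hk4

lemma eq_of_trace_eq_zero {M : Matrix (Fin 2) (Fin 2) (ZMod 5)} (h : M.trace = 0) :
    M = !![M 0 0, M 0 1; M 1 0, -M 0 0] := by
  rw [trace_fin_two] at h
  ext i j
  fin_cases i <;> fin_cases j <;> simp
  linear_combination h

lemma frameIndex_spec {M : Matrix (Fin 2) (Fin 2) (ZMod 5)} (hM : M.trace = 0)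
    (hd : M.det ^ 2 = 1) :
    M = M 0 0 • frameMatrix (frameIndex M) ∨ (M * frameMatrix (frameIndex M)).trace = 0 := by
  have key : ∀ x y z : ZMod 5, (x * x + y * z) ^ 2 = 1 →
      (z = 0 ∧ y = x * (3 * (x * z ^ 3 + 2 * y * x ^ 3 * (1 - z ^ 4)))) ∨
        2 * x + 3 * (x * z ^ 3 + 2 * y * x ^ 3 * (1 - z ^ 4)) * z = 0 := by
    decide +kernel
  rw [eq_of_trace_eq_zero hM, det_fin_two] at hd
  refine (key (M 0 0) (M 0 1) (M 1 0) (by simp at hd; linear_combination hd)).imp ?_ ?_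
  · rintro ⟨h1, h2⟩
    conv_lhs => rw [eq_of_trace_eq_zero hM]
    change M 0 1 = M 0 0 * (3 * frameIndex M) at h2
    ext i j
    fin_cases i <;> fin_cases j <;> simp [frameMatrix, h1, ← h2]
  · intro h
    change 2 * M 0 0 + 3 * frameIndex M * M 1 0 = 0 at h
    rw [trace_fin_two] at hM ⊢
    simp only [mul_apply, Fin.sum_univ_two, frameMatrix, of_apply, cons_val', cons_val_zero,
      cons_val_one, cons_val_fin_one]
    linear_combination h - hM

lemma frameIndex_eq {M N : Matrix (Fin 2) (Fin 2) (ZMod 5)} (hM : M.trace = 0)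
    (hMd : M.det ^ 2 = 1) (hN : N.trace = 0) (hNd : N.det ^ 2 = 1) (h : (M * N).trace = 0) :
    frameIndex M = frameIndex N := by
  have key : ∀ x y z : ZMod 5, (x * x + y * z) ^ 2 = 1 → ∀ x' y' z' : ZMod 5,
      (x' * x' + y' * z') ^ 2 = 1 → 2 * x * x' + y * z' + z * y' = 0 →
      x * z ^ 3 + 2 * y * x ^ 3 * (1 - z ^ 4) = x' * z' ^ 3 + 2 * y' * x' ^ 3 * (1 - z' ^ 4) := by
    decide +kernel
  rw [eq_of_trace_eq_zero hM, det_fin_two] at hMd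
  rw [eq_of_trace_eq_zero hN, det_fin_two] at hNd
  rw [eq_of_trace_eq_zero hM, eq_of_trace_eq_zero hN, trace_fin_two] at h
  simp [mul_apply, Fin.sum_univ_two] at hMd hNd h
  exact key _ _ _ (by linear_combination hMd) _ _ _ (by linear_combination hNd)
    (by linear_combination h)

lemma trace_conj_adjugate (M X : Matrix (Fin 2) (Fin 2) (ZMod 5)) :
    (M * X * M.adjugate).trace = M.det * X.trace := by
  rw [Matrix.trace_mul_comm, ← Matrix.mul_assoc, adjugate_mul, smul_mul, Matrix.one_mul,
    trace_smul, smul_eq_mul]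

lemma det_conj_adjugate (M X : Matrix (Fin 2) (Fin 2) (ZMod 5)) :
    (M * X * M.adjugate).det = M.det ^ 2 * X.det := by
  simp only [det_mul, det_adjugate, Fintype.card_fin]
  ring

lemma trace_conj_mul_conj (M X Y : Matrix (Fin 2) (Fin 2) (ZMod 5)) :
    ((M * X * M.adjugate) * (M * Y * M.adjugate)).trace = M.det ^ 2 * (X * Y).trace := by
  have h : (M * X * M.adjugate) * (M * Y * M.adjugate) =
      M.det • (M * (X * Y) * M.adjugate) := by
    rw [show (M * X * M.adjugate) * (M * Y * M.adjugate) =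
      M * X * (M.adjugate * M) * Y * M.adjugate by simp only [Matrix.mul_assoc], adjugate_mul]
    simp only [smul_mul, Matrix.mul_smul, Matrix.mul_assoc, Matrix.one_mul]
  rw [h, trace_smul, trace_conj_adjugate, smul_eq_mul]
  ring

lemma trace_frameMatrix (t : ZMod 5) : (frameMatrix t).trace = 0 := by
  simp [frameMatrix, trace_fin_two]

lemma det_frameMatrix (t : ZMod 5) : (frameMatrix t).det = -1 := by
  simp [frameMatrix]

lemma frameIndex_conj {M X : Matrix (Fin 2) (Fin 2) (ZMod 5)} (hM : M.det ≠ 0)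
    (hX : X.trace = 0) (hXd : X.det ^ 2 = 1) :
    frameIndex (M * X * M.adjugate) =
      frameIndex (M * frameMatrix (frameIndex X) * M.adjugate) := by
  have hM4 := pow_four_eq_one hM
  rcases frameIndex_spec hX hXd with h | h
  · have h0 : X 0 0 ≠ 0 := by
      intro h0
      rw [h, h0] at hXd
      simp at hXd
      exact absurd hXd (by decide)
    conv_lhs => rw [h]
    rw [Matrix.mul_smul, smul_mul, frameIndex_smul h0]
  · apply frameIndex_eq
    · rw [trace_conj_adjugate, hX, mul_zero]
    · rw [det_conj_adjugate]
      linear_combination M.det ^ 4 * hXd + hM4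
    · rw [trace_conj_adjugate, trace_frameMatrix, mul_zero]
    · rw [det_conj_adjugate, det_frameMatrix]
      linear_combination hM4
    · rw [trace_conj_mul_conj, h, mul_zero]

lemma frameIndex_frameMatrix (t : ZMod 5) : frameIndex (frameMatrix t) = t := by
  revert t
  decide

/-- The permutation action of `GL(2, 5)` on the five partitions of the projective line into three
pairs that are preserved by a Klein four-group inside `PSL(2, 5)`. -/
def frameHom : GL (Fin 2) (ZMod 5) →* Equiv.Perm (ZMod 5) :=
  MonoidHom.toHomPerm
    { toFun := fun u t => frameIndex (u.val * frameMatrix t * u.val.adjugate)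
      map_one' := funext fun t => by
        rw [Units.val_one, adjugate_one, Matrix.one_mul, Matrix.mul_one, frameIndex_frameMatrix]
        rfl
      map_mul' := fun u w => funext fun t => by
        change _ = frameIndex (_ * frameMatrix (frameIndex _) * _)
        rw [← frameIndex_conj (det_ne_zero_zmod_five u), Units.val_mul, adjugate_mul_distrib]
        · simp only [Matrix.mul_assoc]
        · rw [trace_conj_adjugate, trace_frameMatrix, mul_zero]
        · rw [det_conj_adjugate, det_frameMatrix]
          linear_combination pow_four_eq_one (det_ne_zero_zmod_five w) }

lemma frameHom_apply (u : GL (Fin 2) (ZMod 5)) (t : ZMod 5) :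
    frameHom u t = frameIndex (u.val * frameMatrix t * u.val.adjugate) := rfl

lemma frameHom_eq_one_iff {u : GL (Fin 2) (ZMod 5)} :
    frameHom u = 1 ↔ u 0 1 = 0 ∧ u 1 0 = 0 ∧ u 0 0 = u 1 1 := by
  have key : ∀ a b c d : ZMod 5, a * d - b * c ≠ 0 →
      ((∀ t, frameIndex (!![a, b; c, d] * frameMatrix t * !![d, -b; -c, a]) = t) ↔
        b = 0 ∧ c = 0 ∧ a = d) := by
    decide +kernel
  have hu := det_ne_zero_zmod_five u
  rw [det_fin_two] at hu
  rw [← key _ _ _ _ hu, Equiv.ext_iff]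
  simp only [frameHom_apply, adjugate_fin_two, Equiv.Perm.one_apply, ← eta_fin_two]

/-- Invertible matrices acting as the adjacent transpositions under `frameHom`. -/
def adjacentMatrix : Fin 4 → Matrix (Fin 2) (Fin 2) (ZMod 5) :=
  ![!![1, 1; 2, 4], !![1, 4; 4, 4], !![0, 1; 3, 0], !![1, 1; 1, 4]]

lemma isUnit_det_adjacentMatrix (i : Fin 4) : IsUnit (adjacentMatrix i).det := by
  apply IsUnit.of_mul_eq_one ((adjacentMatrix i).det ^ 3)
  revert i
  decide +kernel

/-- The adjacent transpositions of `ZMod 5`. -/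
def adjacentSwap (i : Fin 4) : Equiv.Perm (ZMod 5) := Equiv.swap (α := Fin 5) i.castSucc i.succ

lemma frameIndex_adjacentMatrix (i : Fin 4) (t : ZMod 5) :
    frameIndex (adjacentMatrix i * frameMatrix t * (adjacentMatrix i).adjugate) =
      adjacentSwap i t := by
  revert i t
  decide +kernel

lemma frameHom_adjacentMatrix (i : Fin 4) :
    frameHom (GeneralLinearGroup.mk'' (adjacentMatrix i) (isUnit_det_adjacentMatrix i)) =
      adjacentSwap i := by
  ext1 t
  rw [frameHom_apply]
  exact frameIndex_adjacentMatrix i t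

lemma exists_isStringCGroupRep {F : Type*} [Field F] [Fintype F] (hF : Fintype.card F = 5) :
    ∃ ρ : Fin 4 → ProjectiveGeneralLinearGroup (Fin 2) F, IsStringCGroupRep ρ := by
  have : Fact (Nat.Prime 5) := ⟨by norm_num⟩
  have e : F ≃+* ZMod 5 := FiniteField.ringEquivOfCardEq (by simp [hF])
  have hker : ∀ u : GL (Fin 2) F, frameHom (GeneralLinearGroup.map e.toRingHom u) = 1 ↔
      ProjectiveGeneralLinearGroup.mk u = 1 := by
    intro u
    rw [frameHom_eq_one_iff, ProjectiveGeneralLinearGroup.mk_eq_one_iff]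
    simp
  let φ : ProjectiveGeneralLinearGroup (Fin 2) F →* Equiv.Perm (ZMod 5) :=
    QuotientGroup.lift _ (frameHom.comp (GeneralLinearGroup.map e.toRingHom)) fun u hu =>
      (hker u).mpr ((QuotientGroup.eq_one_iff u).mpr hu)
  have hφ : Function.Injective φ := by
    rw [injective_iff_map_eq_one]
    intro g hg
    induction g using QuotientGroup.induction_on with | H u =>
    exact (hker u).mp hg
  let ρ : Fin 4 → ProjectiveGeneralLinearGroup (Fin 2) F := fun i =>
    ProjectiveGeneralLinearGroup.mk (GeneralLinearGroup.map e.symm.toRingHom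
      (GeneralLinearGroup.mk'' (adjacentMatrix i) (isUnit_det_adjacentMatrix i)))
  have hρ : φ ∘ ρ = adjacentSwap := by
    ext1 i
    have h : GeneralLinearGroup.map e.toRingHom (GeneralLinearGroup.map e.symm.toRingHom
        (GeneralLinearGroup.mk'' (adjacentMatrix i) (isUnit_det_adjacentMatrix i))) =
        GeneralLinearGroup.mk'' (adjacentMatrix i) (isUnit_det_adjacentMatrix i) := by
      ext
      simp
    rw [← frameHom_adjacentMatrix, ← h]
    rfl
  have h4 : IsStringCGroupRep adjacentSwap := isStringCGroupRep_swap 4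
  exact ⟨ρ, .of_injective φ hφ (hρ ▸ h4)⟩

end FiveFrames

/-- Every string C-group representation of `PGL(2, F)` has rank at most four, and
a rank-four representation exists iff `|F| = 5`. -/
theorem pgl2_stringCRank (F : Type*) [Field F] [Fintype F] :
    (∀ (n : ℕ) (ρ : Fin n → ProjectiveGeneralLinearGroup (Fin 2) F),
      IsStringCGroupRep ρ → n ≤ 4) ∧
    ((∃ ρ : Fin 4 → ProjectiveGeneralLinearGroup (Fin 2) F, IsStringCGroupRep ρ) ↔
      Fintype.card F = 5) := by
  refine ⟨fun n ρ h => ?_, fun ⟨ρ, h⟩ => ?_, exists_isStringCGroupRep⟩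
  · by_cases h2 : (2 : F) = 0
    · exact (h.lt_four_of_char_two h2).le
    · exact h.le_four_of_isCrossUnique (ProjectiveGeneralLinearGroup.isCrossUnique h2)
  · refine h.isStringQuadruple.card_eq_five fun h2 => ?_
    exact (h.lt_four_of_char_two h2).false
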